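/- arXiv:1005.4194 — 2 statements merged into one kernel-verified Lean document; each statement's English description precedes it below -/
import Mathlib

section
/- The ring R(A,𝔫,L) is an integral domain which is integrally closed in its field of fractions (i.e., R(A,𝔫,L) is a normal domain). -/
open MvPolynomial

section Setup

variable (𝕂 : Type) [Field 𝕂] [IsAlgClosed 𝕂] [CharZero 𝕂]
variable (r : ℕ) (a : Fin (r+1) → 𝕂 × 𝕂) (n : Fin (r+1) → ℕ)
variable (l : ∀ i : Fin (r+1), Fin (n i) → ℕ)

/-- The index set of the variables `T_{ij}`, `0 ≤ i ≤ r`, `1 ≤ j ≤ n_i`. -/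
abbrev Idx (r : ℕ) (n : Fin (r+1) → ℕ) := Σ i : Fin (r+1), Fin (n i)

/-- The monomial `T_i^{l_i} = T_{i1}^{l_{i1}} ⋯ T_{i n_i}^{l_{i n_i}}`. -/
noncomputable def mono (i : Fin (r+1)) : MvPolynomial (Idx r n) 𝕂 :=
  ∏ j : Fin (n i), (X ⟨i, j⟩ : MvPolynomial (Idx r n) 𝕂) ^ l i j

/-- `α_{ij} = det(a_i, a_j)`. -/
def alpha (i k : Fin (r+1)) : 𝕂 := (a i).1 * (a k).2 - (a k).1 * (a i).2

/-- The trinomial `g_{i,j,k} = α_{jk} T_i^{l_i} + α_{ki} T_j^{l_j} + α_{ij} T_k^{l_k}`. -/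
noncomputable def gPoly (i j k : Fin (r+1)) : MvPolynomial (Idx r n) 𝕂 :=
  C (alpha 𝕂 r a j k) * mono 𝕂 r n l i + C (alpha 𝕂 r a k i) * mono 𝕂 r n l j +
    C (alpha 𝕂 r a i j) * mono 𝕂 r n l k

/-- The ideal `⟨g_{i,i+1,i+2} ; 0 ≤ i ≤ r-2⟩`. -/
noncomputable def relIdeal : Ideal (MvPolynomial (Idx r n) 𝕂) :=
  Ideal.span { p | ∃ i j k : Fin (r+1), (j : ℕ) = (i : ℕ) + 1 ∧ (k : ℕ) = (i : ℕ) + 2 ∧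
    p = gPoly 𝕂 r a n l i j k }

/-- The ring `R(A, 𝔫, L)`. -/
abbrev RAnL := MvPolynomial (Idx r n) 𝕂 ⧸ relIdeal 𝕂 r a n l

/-- Row `i` (for `1 ≤ i ≤ r`) of the `r × n` matrix `P`. -/
def Prow (i : Fin r) : Idx r n → ℤ :=
  fun x => if x.1 = 0 then -(l x.1 x.2 : ℤ) else if x.1 = i.succ then (l x.1 x.2 : ℤ) else 0

/-- The subgroup of `ℤ^n` generated by the rows of `P`. -/
def rowSpan : AddSubgroup (Idx r n → ℤ) := AddSubgroup.closure (Set.range (Prow r n l))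

/-- The grading group `K = ℤ^n / P^*(M)`. -/
abbrev Kgrp := (Idx r n → ℤ) ⧸ rowSpan r n l

/-- The projection `Q : ℤ^n → K`. -/
noncomputable def Qmap : (Idx r n → ℤ) →+ Kgrp r n l := QuotientAddGroup.mk' (rowSpan r n l)

/-- The weight `deg T_{ij} := Q(e_{ij})` defining the `K`-grading of `S`. -/
noncomputable def wK : Idx r n → Kgrp r n l := fun x => Qmap r n l (Pi.single x (1 : ℤ))

/-- An element of `R(A,𝔫,L)` is homogeneous of degree `d` if it is the image of a
`K`-homogeneous polynomial of degree `d`. -/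
def IsHomog (d : Kgrp r n l) (y : RAnL 𝕂 r a n l) : Prop :=
  ∃ p : MvPolynomial (Idx r n) 𝕂, p.IsWeightedHomogeneous (wK r n l) d ∧
    Ideal.Quotient.mk (relIdeal 𝕂 r a n l) p = y

/-- `K`-prime elements of `R(A,𝔫,L)`. -/
def KPrime (f : RAnL 𝕂 r a n l) : Prop :=
  (∃ d, IsHomog 𝕂 r a n l d f) ∧ f ≠ 0 ∧ ¬ IsUnit f ∧
    ∀ x y : RAnL 𝕂 r a n l, (∃ d, IsHomog 𝕂 r a n l d x) → (∃ d, IsHomog 𝕂 r a n l d y) →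
      f ∣ x * y → f ∣ x ∨ f ∣ y

end Setup

/-- A family of elements of a normal domain that are nonzero nonunits, generate radical ideals and
are pairwise regular sequences. -/
structure RadicalRegularFamily {A ι : Type*} [CommRing A] (F : ι → A) : Prop where
  isDomain : IsDomain A
  isIntegrallyClosed : IsIntegrallyClosed A
  ne_zero : ∀ i, F i ≠ 0
  not_isUnit : ∀ i, ¬ IsUnit (F i)
  isRadical : ∀ i, IsRadical (F i)
  regular : ∀ i j, i ≠ j → ∀ x, F i ∣ F j * x → F i ∣ x

section RingLemmas

variable {B Q : Type*} [CommRing B] [CommRing Q]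

theorem isRadical_of_ker {b : B} (π : B →+* Q) (h : ∀ y, b ∣ y ↔ π y = 0) [IsReduced Q] :
    IsRadical b := by
  intro n y hy
  rw [h, map_pow] at hy
  exact (h y).2 (eq_zero_of_pow_eq_zero hy)

theorem not_isUnit_of_ker {b : B} (π : B →+* Q) (h : ∀ y, b ∣ y ↔ π y = 0) [Nontrivial Q] :
    ¬ IsUnit b := by
  intro hb
  have := (h 1).1 hb.dvd
  simp at this

theorem dvd_of_dvd_mul_of_ker {b c : B} (π : B →+* Q) (h : ∀ y, b ∣ y ↔ π y = 0)
    (hc : π c ∈ nonZeroDivisors Q) (x : B) (hx : b ∣ c * x) : b ∣ x := by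
  rw [h, map_mul, mul_comm] at hx
  exact (h x).2 (mul_right_mem_nonZeroDivisors_eq_zero_iff hc |>.1 hx)

theorem regular_symm [IsDomain B] {b c : B} (hb : b ≠ 0)
    (h : ∀ x, b ∣ c * x → b ∣ x) (x : B) (hx : c ∣ b * x) : c ∣ x := by
  obtain ⟨y, hy⟩ := hx
  obtain ⟨z, rfl⟩ := h y ⟨x, hy.symm⟩
  exact ⟨z, mul_left_cancel₀ hb (by rw [hy]; ring)⟩

theorem dvd_of_dvd_pow_mul {b c : B} (h : ∀ x, b ∣ c * x → b ∣ x) (n : ℕ) (x : B)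
    (hx : b ∣ c ^ n * x) : b ∣ x := by
  induction n with
  | zero => simpa using hx
  | succ n ih => exact ih (h _ (by rwa [pow_succ', mul_assoc] at hx))

theorem pow_dvd_of_pow_dvd_mul [IsDomain B] {b c : B} (hb : b ≠ 0)
    (h : ∀ x, b ∣ c * x → b ∣ x) (n : ℕ) (x : B)
    (hx : b ^ n ∣ c * x) : b ^ n ∣ x := by
  induction n generalizing x with
  | zero => simp
  | succ n ih =>
    obtain ⟨y, rfl⟩ := h x ((dvd_pow_self b n.succ_ne_zero).trans hx)
    rw [pow_succ']
    refine mul_dvd_mul_left b (ih y ?_)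
    rw [pow_succ', mul_left_comm] at hx
    exact (mul_dvd_mul_iff_left hb).1 hx

theorem quotient_mk_mem_nonZeroDivisors {b c : B} (h : ∀ x, b ∣ c * x → b ∣ x) :
    Ideal.Quotient.mk (Ideal.span {b}) c ∈ nonZeroDivisors (B ⧸ Ideal.span {b}) := by
  rw [mem_nonZeroDivisors_iff_right]
  intro x hx
  obtain ⟨x, rfl⟩ := Ideal.Quotient.mk_surjective x
  rw [← map_mul, Ideal.Quotient.eq_zero_iff_mem, Ideal.mem_span_singleton] at hx
  rw [Ideal.Quotient.eq_zero_iff_mem, Ideal.mem_span_singleton]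
  exact h x (by rwa [mul_comm])

theorem IsRadical.isReduced_quotient_span {b : B} (h : IsRadical b) :
    IsReduced (B ⧸ Ideal.span {b}) :=
  (Ideal.isRadical_iff_quotient_reduced _).1 (isRadical_iff_span_singleton.1 h)

theorem nontrivial_quotient_span {b : B} (h : ¬ IsUnit b) : Nontrivial (B ⧸ Ideal.span {b}) :=
  Ideal.Quotient.nontrivial_iff.2 (by rwa [Ne, Ideal.span_singleton_eq_top])

theorem dvd_iff_quotient_mk_eq_zero {b y : B} :
    b ∣ y ↔ Ideal.Quotient.mk (Ideal.span {b}) y = 0 := by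
  rw [Ideal.Quotient.eq_zero_iff_mem, Ideal.mem_span_singleton]

/-- A multiple `t ^ n * x` of an integral fraction `x` lies in `B` if the localization at `t` is
normal. -/
theorem exists_pow_mul_eq_algebraMap [IsDomain B] {t : B} (ht : t ≠ 0) (L : Type*) [CommRing L]
    [Algebra B L] [IsLocalization.Away t L] [IsIntegrallyClosed L] {x : FractionRing B}
    (hx : IsIntegral B x) : ∃ n b, algebraMap B (FractionRing B) (t ^ n) * x = algebraMap B _ b := by
  have hM : Submonoid.powers t ≤ nonZeroDivisors B :=
    powers_le_nonZeroDivisors_of_noZeroDivisors ht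
  let g : L →+* FractionRing B :=
    IsLocalization.lift (M := Submonoid.powers t) (g := algebraMap B (FractionRing B)) fun y =>
      IsLocalization.map_units (FractionRing B) (⟨y.1, hM y.2⟩ : nonZeroDivisors B)
  let := g.toAlgebra
  have : IsScalarTower B L (FractionRing B) := IsScalarTower.of_algebraMap_eq'
    (IsLocalization.lift_comp _).symm
  have := IsFractionRing.isFractionRing_of_isDomain_of_isLocalization (Submonoid.powers t) L
    (FractionRing B)
  have : IsDomain L := IsLocalization.isDomain_of_le_nonZeroDivisors L hM
  obtain ⟨y, rfl⟩ := (isIntegrallyClosed_iff (FractionRing B)).1 ‹IsIntegrallyClosed L›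
    (hx.tower_top (A := L))
  obtain ⟨⟨b, ⟨_, n, rfl⟩⟩, h⟩ := IsLocalization.surj (Submonoid.powers t) y
  refine ⟨n, b, ?_⟩
  simp only at h
  rw [IsScalarTower.algebraMap_apply B L (FractionRing B) (t ^ n),
    IsScalarTower.algebraMap_apply B L (FractionRing B) b, ← map_mul, ← h, mul_comm]

/-- A domain is normal if two localizations away from the members of a regular sequence are. -/
theorem IsIntegrallyClosed.of_regular_pair [IsDomain B] {t w : B} (ht : t ≠ 0) (hw : w ≠ 0)
    (h : ∀ x, t ∣ w * x → t ∣ x) (L L' : Type*) [CommRing L] [CommRing L']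
    [Algebra B L] [IsLocalization.Away t L] [IsIntegrallyClosed L]
    [Algebra B L'] [IsLocalization.Away w L'] [IsIntegrallyClosed L'] :
    IsIntegrallyClosed B := by
  rw [isIntegrallyClosed_iff (FractionRing B)]
  intro x hx
  obtain ⟨n, b, hb⟩ := exists_pow_mul_eq_algebraMap ht L hx
  obtain ⟨m, c, hc⟩ := exists_pow_mul_eq_algebraMap hw L' hx
  have key : w ^ m * b = t ^ n * c := by
    apply FaithfulSMul.algebraMap_injective B (FractionRing B)
    rw [map_mul, map_mul, ← hb, ← hc]; ring
  obtain ⟨d, rfl⟩ : t ^ n ∣ b := by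
    have : ∀ m, t ^ n ∣ w ^ m * b → t ^ n ∣ b := fun m =>
      dvd_of_dvd_pow_mul (fun x => pow_dvd_of_pow_dvd_mul ht h n x) m b
    exact this m ⟨c, key⟩
  refine ⟨d, ?_⟩
  rw [map_mul] at hb
  refine (mul_left_cancel₀ ?_ hb).symm
  simpa using fun h => absurd h ht

end RingLemmas

instance {A : Type*} [CommRing A] [IsReduced A] : IsReduced (Polynomial A) :=
  ⟨fun p hp => by
    ext i
    exact (Polynomial.isNilpotent_iff.1 hp i).eq_zero⟩

instance {A : Type*} [CommRing A] [IsReduced A] : IsReduced (LaurentPolynomial A) :=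
  isReduced_localizationPreserves (Submonoid.powers (Polynomial.X : Polynomial A)) _ inferInstance

section SplitRing

/-- The ring `A[t, w] / (t * w - f)`. -/
abbrev SplitRing {A : Type*} [CommRing A] (f : A) : Type _ :=
  AdjoinRoot (Polynomial.C Polynomial.X * Polynomial.X - Polynomial.C (Polynomial.C f) :
    Polynomial (Polynomial A))

namespace SplitRing

variable {A : Type*} [CommRing A] (f : A)

/-- The structure map of the ring `A[t, w] / (t * w - f)`. -/
noncomputable def base : A →+* SplitRing f := (AdjoinRoot.of _).comp Polynomial.C

/-- The element `t` of `A[t, w] / (t * w - f)`. -/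
noncomputable def left : SplitRing f := AdjoinRoot.of _ Polynomial.X

/-- The element `w` of `A[t, w] / (t * w - f)`. -/
noncomputable def right : SplitRing f := AdjoinRoot.root _

theorem left_mul_right : left f * right f = base f f := by
  have h := AdjoinRoot.eval₂_root (Polynomial.C Polynomial.X * Polynomial.X -
    Polynomial.C (Polynomial.C f) : Polynomial (Polynomial A))
  rw [Polynomial.eval₂_sub, Polynomial.eval₂_mul, Polynomial.eval₂_C, Polynomial.eval₂_C,
    Polynomial.eval₂_X, sub_eq_zero] at h
  exact h

variable {f}

/-- The ring homomorphism from `A[t, w] / (t * w - f)` given by the images of `t` and `w`. -/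
noncomputable def lift {C : Type*} [CommRing C] (ψ : A →+* C) (t w : C) (h : t * w = ψ f) :
    SplitRing f →+* C :=
  AdjoinRoot.lift (Polynomial.eval₂RingHom ψ t) w (by simp [h])

section lift

variable {C : Type*} [CommRing C] (ψ : A →+* C) (t w : C) (h : t * w = ψ f)

@[simp] theorem lift_base (a : A) : lift ψ t w h (base f a) = ψ a := by simp [lift, base]

@[simp] theorem lift_left : lift ψ t w h (left f) = t := by simp [lift, left]

@[simp] theorem lift_right : lift ψ t w h (right f) = w := by simp [lift, right]

theorem lift_comp_base : (lift ψ t w h).comp (base f) = ψ := RingHom.ext (lift_base ψ t w h)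

end lift

theorem hom_ext {C : Type*} [CommRing C] {χ χ' : SplitRing f →+* C}
    (h : χ.comp (base f) = χ'.comp (base f)) (hl : χ (left f) = χ' (left f))
    (hr : χ (right f) = χ' (right f)) : χ = χ' := by
  refine AdjoinRoot.ringHom_ext (Polynomial.ringHom_ext (fun a => ?_) hl) hr
  exact RingHom.congr_fun h a

theorem induction {P : SplitRing f → Prop} (hbase : ∀ a, P (base f a))
    (hadd : ∀ x y, P x → P y → P (x + y)) (hleft : ∀ x, P x → P (left f * x))
    (hright : ∀ x, P x → P (right f * x)) (x : SplitRing f) : P x := by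
  have hl : ∀ n y, P y → P (left f ^ n * y) := fun n y hy => by
    induction n with
    | zero => simpa
    | succ n ih => rw [pow_succ', mul_assoc]; exact hleft _ ih
  have hr : ∀ n y, P y → P (right f ^ n * y) := fun n y hy => by
    induction n with
    | zero => simpa
    | succ n ih => rw [pow_succ', mul_assoc]; exact hright _ ih
  have hof : ∀ p, P (AdjoinRoot.of _ p) := fun p => by
    induction p using Polynomial.induction_on' with
    | add p q hp hq => rw [map_add]; exact hadd _ _ hp hq
    | monomial n a =>
      have := hl n _ (hbase a)
      rwa [mul_comm (left f ^ n), base, RingHom.comp_apply, left, ← map_pow, ← map_mul,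
        Polynomial.C_mul_X_pow_eq_monomial] at this
  induction x using AdjoinRoot.induction_on with
  | ih p =>
    induction p using Polynomial.induction_on' with
    | add p q hp hq => rw [map_add]; exact hadd _ _ hp hq
    | monomial n p =>
      have := hr n _ (hof p)
      rwa [mul_comm (right f ^ n), ← AdjoinRoot.mk_C, right, ← AdjoinRoot.mk_X, ← map_pow,
        ← map_mul, Polynomial.C_mul_X_pow_eq_monomial] at this

/-- The normal form `p(t) + w * q(w)`. -/
noncomputable def normalForm (f : A) (p q : Polynomial A) : SplitRing f :=
  p.eval₂ (base f) (left f) + right f * q.eval₂ (base f) (right f)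

theorem exists_eq_normalForm (x : SplitRing f) : ∃ p q, x = normalForm f p q := by
  induction x using induction with
  | hbase a => exact ⟨Polynomial.C a, 0, by simp [normalForm]⟩
  | hadd x y hx hy =>
    obtain ⟨p, q, rfl⟩ := hx
    obtain ⟨p', q', rfl⟩ := hy
    exact ⟨p + p', q + q', by simp [normalForm, Polynomial.eval₂_add]; ring⟩
  | hleft x hx =>
    obtain ⟨p, q, rfl⟩ := hx
    refine ⟨Polynomial.X * p + Polynomial.C (f * q.coeff 0), Polynomial.C f * q.divX, ?_⟩
    have hq := congrArg (Polynomial.eval₂ (base f) (right f)) q.divX_mul_X_add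
    simp only [normalForm, Polynomial.eval₂_add, Polynomial.eval₂_mul, Polynomial.eval₂_X,
      Polynomial.eval₂_C, map_mul] at hq ⊢
    rw [← hq, ← left_mul_right]
    ring
  | hright x hx =>
    obtain ⟨p, q, rfl⟩ := hx
    refine ⟨Polynomial.C f * p.divX, Polynomial.X * q + Polynomial.C (p.coeff 0), ?_⟩
    have hp := congrArg (Polynomial.eval₂ (base f) (left f)) p.divX_mul_X_add
    simp only [normalForm, Polynomial.eval₂_add, Polynomial.eval₂_mul, Polynomial.eval₂_X,
      Polynomial.eval₂_C] at hp ⊢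
    rw [← hp, ← left_mul_right]
    ring

/-- The map `A[t, w] / (t * w - f) → C[t, t⁻¹]` induced by a ring homomorphism `A → C`. -/
noncomputable def toLaurent {C : Type*} [CommRing C] (φ : A →+* C) :
    SplitRing f →+* LaurentPolynomial C :=
  lift (LaurentPolynomial.C.comp φ) (LaurentPolynomial.T 1)
    (LaurentPolynomial.C (φ f) * LaurentPolynomial.T (-1)) (by
      rw [mul_left_comm, ← LaurentPolynomial.T_add]; simp)

theorem toLaurent_normalForm {C : Type*} [CommRing C] (φ : A →+* C) (p q : Polynomial A) :
    toLaurent φ (normalForm f p q) = (p.map φ).toLaurent + LaurentPolynomial.invert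
      (Polynomial.X * (Polynomial.C (φ f) *
        (q.map φ).comp (Polynomial.C (φ f) * Polynomial.X))).toLaurent := by
  have h1 : ∀ p : Polynomial A, p.eval₂ (LaurentPolynomial.C.comp φ) (LaurentPolynomial.T 1) =
      (p.map φ).toLaurent := fun p => by
    induction p using Polynomial.induction_on' with
    | add p q hp hq => simp [Polynomial.eval₂_add, hp, hq]
    | monomial n a => simp [← Polynomial.C_mul_X_pow_eq_monomial]
  have h2 : q.eval₂ (LaurentPolynomial.C.comp φ) (LaurentPolynomial.C (φ f) *
      LaurentPolynomial.T (-1)) = LaurentPolynomial.invert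
        ((q.map φ).comp (Polynomial.C (φ f) * Polynomial.X)).toLaurent := by
    induction q using Polynomial.induction_on' with
    | add p q hp hq => simp [Polynomial.eval₂_add, hp, hq]
    | monomial n a => simp [← Polynomial.C_mul_X_pow_eq_monomial, mul_pow]
  simp only [normalForm, map_add, map_mul, Polynomial.hom_eval₂]
  simp only [toLaurent, lift_comp_base, lift_left, lift_right]
  rw [h1, h2]
  simp
  ring

theorem _root_.LaurentPolynomial.coeff_toLaurent_natCast {C : Type*} [CommRing C]
    (p : Polynomial C) (n : ℕ) : p.toLaurent.coeff (n : ℤ) = p.coeff n := by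
  rw [LaurentPolynomial.coeff_toLaurent]
  exact Finsupp.mapDomain_apply Nat.castEmbedding.injective _ _

theorem _root_.LaurentPolynomial.coeff_toLaurent_of_neg {C : Type*} [CommRing C]
    (p : Polynomial C) (n : ℤ) (hn : n < 0) : p.toLaurent.coeff n = 0 := by
  rw [LaurentPolynomial.coeff_toLaurent]
  refine Finsupp.mapDomain_of_notMem_range _ _ ?_
  rintro ⟨m, rfl⟩
  simp at hn
  omega

theorem toLaurent_normalForm_eq_zero {C : Type*} [CommRing C] {φ : A →+* C}
    (hf : φ f ∈ nonZeroDivisors C) {p q : Polynomial A}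
    (h : toLaurent φ (normalForm f p q) = 0) :
    (∀ n, φ (p.coeff n) = 0) ∧ ∀ n, φ (q.coeff n) = 0 := by
  rw [toLaurent_normalForm] at h
  have hc := fun n : ℤ => congrArg (fun x => x.coeff n) h
  simp only [AddMonoidAlgebra.coeff_add, Finsupp.add_apply, LaurentPolynomial.invert_apply,
    AddMonoidAlgebra.coeff_zero, Finsupp.zero_apply] at hc
  constructor
  · intro n
    have := hc n
    rcases Nat.eq_zero_or_pos n with rfl | hn
    · have h0 : (-((0 : ℕ) : ℤ)) = ((0 : ℕ) : ℤ) := by simp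
      rw [h0, LaurentPolynomial.coeff_toLaurent_natCast,
        LaurentPolynomial.coeff_toLaurent_natCast] at this
      simpa using this
    · rw [LaurentPolynomial.coeff_toLaurent_natCast,
        LaurentPolynomial.coeff_toLaurent_of_neg _ _ (by omega)] at this
      simpa using this
  · intro n
    have := hc (-((n + 1 : ℕ) : ℤ))
    rw [neg_neg, LaurentPolynomial.coeff_toLaurent_natCast,
      LaurentPolynomial.coeff_toLaurent_of_neg _ _ (by omega), zero_add,
      Polynomial.coeff_X_mul, Polynomial.coeff_C_mul, Polynomial.comp_C_mul_X_coeff,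
      Polynomial.coeff_map, mul_comm, mul_assoc, ← pow_succ] at this
    exact (mul_right_mem_nonZeroDivisors_eq_zero_iff (pow_mem hf _)).1 this

end SplitRing
end SplitRing

namespace SplitRing

variable {A : Type*} [CommRing A] {f : A}

theorem base_dvd_iff {c : A} (hc : ∀ x, c ∣ f * x → c ∣ x) (y : SplitRing f) :
    base f c ∣ y ↔ toLaurent (Ideal.Quotient.mk (Ideal.span {c})) y = 0 := by
  constructor
  · rintro ⟨z, rfl⟩
    rw [map_mul, toLaurent, lift_base]
    simp
  · intro h
    obtain ⟨p, q, rfl⟩ := exists_eq_normalForm y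
    obtain ⟨hp, hq⟩ := toLaurent_normalForm_eq_zero (quotient_mk_mem_nonZeroDivisors hc) h
    simp only [← dvd_iff_quotient_mk_eq_zero] at hp hq
    obtain ⟨p, rfl⟩ := (Polynomial.C_dvd_iff_dvd_coeff c p).2 hp
    obtain ⟨q, rfl⟩ := (Polynomial.C_dvd_iff_dvd_coeff c q).2 hq
    refine ⟨normalForm f p q, ?_⟩
    simp only [normalForm, Polynomial.eval₂_mul, Polynomial.eval₂_C]
    ring

theorem toLaurent_id_injective (hf : f ∈ nonZeroDivisors A) :
    Function.Injective (toLaurent (f := f) (RingHom.id A)) := by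
  rw [injective_iff_map_eq_zero]
  intro y h
  obtain ⟨p, q, rfl⟩ := exists_eq_normalForm y
  obtain ⟨hp, hq⟩ := toLaurent_normalForm_eq_zero (by simpa) h
  obtain rfl : p = 0 := Polynomial.ext (by simpa using hp)
  obtain rfl : q = 0 := Polynomial.ext (by simpa using hq)
  simp [normalForm]

theorem isDomain [IsDomain A] (hf : f ≠ 0) : IsDomain (SplitRing f) :=
  (toLaurent_id_injective (mem_nonZeroDivisors_of_ne_zero hf)).isDomain

/-- The reduction of `A[t, w] / (t * w - f)` modulo `w`. -/
noncomputable def modRight (f : A) : SplitRing f →+* Polynomial (A ⧸ Ideal.span {f}) :=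
  lift (Polynomial.C.comp (Ideal.Quotient.mk _)) Polynomial.X 0 (by
    simp [dvd_iff_quotient_mk_eq_zero.1 (dvd_refl f)])

theorem right_dvd_iff (y : SplitRing f) : right f ∣ y ↔ modRight f y = 0 := by
  constructor
  · rintro ⟨z, rfl⟩
    simp [modRight]
  · intro h
    obtain ⟨p, q, rfl⟩ := exists_eq_normalForm y
    have : p.map (Ideal.Quotient.mk (Ideal.span {f})) = 0 := by
      rw [← h, normalForm, modRight, map_add, map_mul, Polynomial.hom_eval₂, lift_comp_base,
        lift_left, lift_right, zero_mul, add_zero, ← Polynomial.eval₂_map,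
        Polynomial.eval₂_C_X]
    obtain ⟨p, rfl⟩ := (Polynomial.C_dvd_iff_dvd_coeff f p).2 fun n => by
      rw [dvd_iff_quotient_mk_eq_zero, ← Polynomial.coeff_map, this, Polynomial.coeff_zero]
    refine ⟨left f * p.eval₂ (base f) (left f) + q.eval₂ (base f) (right f), ?_⟩
    simp only [normalForm, Polynomial.eval₂_mul, Polynomial.eval₂_C]
    rw [← left_mul_right]
    ring

/-- The ring homomorphism exchanging `t` and `w` in `A[t, w] / (t * w - f)`. -/
noncomputable def swapHom (f : A) : SplitRing f →+* SplitRing f :=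
  lift (base f) (right f) (left f) (by rw [mul_comm, left_mul_right])

theorem swapHom_comp_swapHom : (swapHom f).comp (swapHom f) = RingHom.id _ := by
  refine hom_ext (RingHom.ext fun a => ?_) ?_ ?_ <;> simp [swapHom]

/-- The automorphism exchanging `t` and `w` in `A[t, w] / (t * w - f)`. -/
noncomputable def swap (f : A) : SplitRing f ≃+* SplitRing f :=
  RingEquiv.ofRingHom (swapHom f) (swapHom f) swapHom_comp_swapHom swapHom_comp_swapHom

theorem swap_apply (x : SplitRing f) : swap f x = swapHom f x :=
  RingEquiv.ofRingHom_apply _ _ _ _ x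

@[simp] theorem swap_base (a : A) : swap f (base f a) = base f a := by
  rw [swap_apply]
  simp [swapHom]

@[simp] theorem swap_left : swap f (left f) = right f := by
  rw [swap_apply]
  simp [swapHom]

theorem left_dvd_iff (y : SplitRing f) :
    left f ∣ y ↔ ((modRight f).comp (swap f : SplitRing f →+* SplitRing f)) y = 0 := by
  rw [← map_dvd_iff (swap f), swap_left, right_dvd_iff]
  rfl

theorem isLocalization_away_left (hf : f ∈ nonZeroDivisors A) :
    letI := (toLaurent (f := f) (RingHom.id A)).toAlgebra
    IsLocalization.Away (left f) (LaurentPolynomial A) := by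
  let := (toLaurent (f := f) (RingHom.id A)).toAlgebra
  have hl : algebraMap (SplitRing f) (LaurentPolynomial A) (left f) = LaurentPolynomial.T 1 := by
    change toLaurent _ _ = _
    simp [toLaurent]
  refine ⟨?_, ?_, ?_⟩
  · rintro ⟨_, n, rfl⟩
    simp only [map_pow, hl]
    exact (LaurentPolynomial.isUnit_T 1).pow n
  · intro z
    obtain ⟨n, p, hp⟩ := LaurentPolynomial.exists_T_pow z
    refine ⟨(normalForm f p 0, ⟨left f ^ n, n, rfl⟩), ?_⟩
    simp only [map_pow, hl, LaurentPolynomial.T_pow, mul_one]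
    rw [← hp]
    refine Eq.symm ((toLaurent_normalForm _ _ _).trans ?_)
    simp
  · intro x y h
    exact ⟨1, by rw [toLaurent_id_injective hf h]⟩

theorem isLocalization_away_right (hf : f ∈ nonZeroDivisors A) :
    letI := ((toLaurent (f := f) (RingHom.id A)).comp
      ((swap f).symm : SplitRing f →+* SplitRing f)).toAlgebra
    IsLocalization.Away (right f) (LaurentPolynomial A) := by
  let := (toLaurent (f := f) (RingHom.id A)).toAlgebra
  have := isLocalization_away_left hf
  have h := IsLocalization.isLocalization_of_base_ringEquiv (Submonoid.powers (left f))
    (LaurentPolynomial A) (swap f)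
  rw [Submonoid.map_powers] at h
  rw [show (swap f) (left f) = right f from swap_left] at h
  exact h

theorem base_ne_zero [Nontrivial A] {c : A} (hc : c ≠ 0) : base f c ≠ 0 := by
  intro h
  have := congrArg (toLaurent (RingHom.id A)) h
  rw [toLaurent, lift_base, map_zero] at this
  exact hc (by simpa using congrArg (fun x => x.coeff 0) this)

theorem left_ne_zero [Nontrivial A] (hf : f ≠ 0) : left f ≠ 0 := fun h =>
  base_ne_zero (f := f) hf (by rw [← left_mul_right, h, zero_mul])

theorem right_ne_zero [Nontrivial A] (hf : f ≠ 0) : right f ≠ 0 := fun h =>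
  base_ne_zero (f := f) hf (by rw [← left_mul_right, h, mul_zero])

theorem right_dvd_of_dvd_left_mul (x : SplitRing f) (h : right f ∣ left f * x) : right f ∣ x := by
  refine dvd_of_dvd_mul_of_ker (modRight f) right_dvd_iff ?_ x h
  rw [modRight, lift_left]
  exact Polynomial.X_mem_nonzeroDivisors

theorem _root_.LaurentPolynomial.C_mem_nonZeroDivisors {c : A} (hc : c ∈ nonZeroDivisors A) :
    LaurentPolynomial.C c ∈ nonZeroDivisors (LaurentPolynomial A) := by
  rw [mem_nonZeroDivisors_iff_right]
  intro x hx
  rw [mul_comm, ← LaurentPolynomial.smul_eq_C_mul] at hx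
  ext n
  have := congrArg (fun y => y.coeff n) hx
  simpa [mul_comm c, mul_right_mem_nonZeroDivisors_eq_zero_iff hc] using this

theorem isIntegrallyClosed [IsDomain A] [IsIntegrallyClosed A] (hf : f ≠ 0) :
    IsIntegrallyClosed (SplitRing f) := by
  have := isDomain hf
  have hf' := mem_nonZeroDivisors_of_ne_zero hf
  have : IsIntegrallyClosed (LaurentPolynomial A) :=
    isIntegrallyClosed_of_isLocalization _ (Submonoid.powers (Polynomial.X : Polynomial A))
      (powers_le_nonZeroDivisors_of_noZeroDivisors Polynomial.X_ne_zero)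
  exact @IsIntegrallyClosed.of_regular_pair _ _ _ _ _ (right_ne_zero hf) (left_ne_zero hf)
    right_dvd_of_dvd_left_mul _ _ _ _ (RingHom.toAlgebra _) (isLocalization_away_right hf') _
    (RingHom.toAlgebra _) (isLocalization_away_left hf') _

open Classical in
/-- The family obtained by replacing the member `F j` by the two factors `t` and `w`. -/
noncomputable def family {ι : Type*} (F : ι → A) (j : ι) : Option ι → SplitRing (F j)
  | none => left (F j)
  | some i => if i = j then right (F j) else base (F j) (F i)

theorem radicalRegularFamily {ι : Type*} {F : ι → A} (hF : RadicalRegularFamily F) (j : ι) :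
    RadicalRegularFamily (family F j) := by
  have := hF.isDomain
  have := hF.isIntegrallyClosed
  have hj := hF.ne_zero j
  have hD : IsDomain (SplitRing (F j)) := isDomain hj
  have hred := (hF.isRadical j).isReduced_quotient_span
  have hnt := nontrivial_quotient_span (hF.not_isUnit j)
  have hb := fun i (hi : i ≠ j) => base_dvd_iff (hF.regular i j hi)
  have hne : ∀ o, family F j o ≠ 0 := by
    rintro (_ | i)
    · exact left_ne_zero hj
    · by_cases hi : i = j
      · simpa [family, hi] using right_ne_zero hj
      · simpa [family, hi] using base_ne_zero (hF.ne_zero i)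
  have hbr : ∀ i, i ≠ j → ∀ x, right (F j) ∣ base (F j) (F i) * x → right (F j) ∣ x :=
    fun i hi => dvd_of_dvd_mul_of_ker _ right_dvd_iff (by
      rw [modRight, lift_base]
      refine Polynomial.mem_nonzeroDivisors_of_coeff_mem 0 ?_
      simpa using quotient_mk_mem_nonZeroDivisors (hF.regular j i hi.symm))
  have hbl : ∀ i, i ≠ j → ∀ x, left (F j) ∣ base (F j) (F i) * x → left (F j) ∣ x := by
    intro i hi x hx
    rw [← map_dvd_iff (swap _)] at hx ⊢
    rw [map_mul, swap_base, swap_left] at hx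
    rw [swap_left]
    exact hbr i hi _ hx
  have hbb : ∀ i k, i ≠ j → k ≠ j → i ≠ k → ∀ x, base (F j) (F i) ∣ base (F j) (F k) * x →
      base (F j) (F i) ∣ x := fun i k hi hk hik => dvd_of_dvd_mul_of_ker _ (hb i hi) (by
      rw [toLaurent, lift_base]
      exact LaurentPolynomial.C_mem_nonZeroDivisors
        (quotient_mk_mem_nonZeroDivisors (hF.regular i k hik)))
  refine ⟨hD, isIntegrallyClosed hj, hne, ?_, ?_, ?_⟩
  · rintro (_ | i)
    · exact not_isUnit_of_ker _ left_dvd_iff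
    · by_cases hi : i = j
      · simpa [family, hi] using not_isUnit_of_ker _ right_dvd_iff
      · have := nontrivial_quotient_span (hF.not_isUnit i)
        simpa [family, hi] using not_isUnit_of_ker _ (hb i hi)
  · rintro (_ | i)
    · exact isRadical_of_ker _ left_dvd_iff
    · by_cases hi : i = j
      · simpa [family, hi] using isRadical_of_ker _ right_dvd_iff
      · have := (hF.isRadical i).isReduced_quotient_span
        simpa [family, hi] using isRadical_of_ker _ (hb i hi)
  · rintro (_ | i) (_ | k) hik
    · exact absurd rfl hik
    · by_cases hk : k = j
      · simpa [family, hk] using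
          regular_symm (right_ne_zero hj) right_dvd_of_dvd_left_mul
      · simpa [family, hk] using hbl k hk
    · by_cases hi : i = j
      · simpa [family, hi] using right_dvd_of_dvd_left_mul
      · simpa [family, hi] using regular_symm (left_ne_zero hj) (hbl i hi)
    · have hik' : i ≠ k := fun h => hik (congrArg some h)
      by_cases hi : i = j
      · have hk : k ≠ j := fun h => hik' (hi.trans h.symm)
        simpa [family, hi, hk] using hbr k hk
      · by_cases hk : k = j
        · simpa [family, hi, hk] using regular_symm (right_ne_zero hj) (hbr i hi)
        · simpa [family, hi, hk] using hbb i k hi hk hik'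

end SplitRing

section Solvable

open scoped Classical in
/-- `B` is the universal `A`-algebra with elements `s k` such that, for each `i`, the product of
the powers `s k ^ l k` over the fiber of `p` over `i` equals `F i`. -/
structure IsUniversalFactorization {A B ι κ : Type} [CommRing A] [CommRing B] [Fintype κ]
    (p : κ → ι) (l : κ → ℕ) (F : ι → A) (φ : A →+* B) (s : κ → B) : Prop where
  rel : ∀ i, ∏ k with p k = i, s k ^ l k = φ (F i)
  lift : ∀ {C : Type} [CommRing C] (ψ : A →+* C) (c : κ → C),
    (∀ i, ∏ k with p k = i, c k ^ l k = ψ (F i)) →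
      ∃ χ : B →+* C, χ.comp φ = ψ ∧ ∀ k, χ (s k) = c k
  ext : ∀ {C : Type} [CommRing C] (χ χ' : B →+* C), χ.comp φ = χ'.comp φ →
    (∀ k, χ (s k) = χ' (s k)) → χ = χ'

/-- Every radical regular family over a `K`-algebra has a universal factorization of type
`(p, l)` whose elements form a radical regular family again. -/
def HasRadicalFactorization (K : Type) [CommRing K] {ι κ : Type} [Fintype κ] (p : κ → ι)
    (l : κ → ℕ) : Prop :=
  ∀ (A : Type) [CommRing A] (_ : K →+* A) (F : ι → A), RadicalRegularFamily F →
    ∃ (B : Type) (_ : CommRing B) (φ : A →+* B) (s : κ → B),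
      RadicalRegularFamily s ∧ IsUniversalFactorization p l F φ s

namespace IsUniversalFactorization

variable {A B D ι κ μ : Type} [CommRing A] [CommRing B] [CommRing D] [Fintype κ] [Fintype μ]

open scoped Classical in
theorem _root_.Finset.prod_fiber_comp {C : Type*} [CommMonoid C] (p : κ → ι) (p' : μ → κ)
    (l : κ → ℕ) (l' : μ → ℕ) (c : μ → C) (i : ι) :
    ∏ k with p k = i, (∏ m with p' m = k, c m ^ l' m) ^ l k =
      ∏ m with p (p' m) = i, c m ^ (l' m * l (p' m)) := by
  rw [← Finset.prod_fiberwise_of_maps_to (s := Finset.univ.filter fun m => p (p' m) = i)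
    (t := Finset.univ.filter fun k => p k = i) (g := p') (by simp)]
  refine Finset.prod_congr rfl fun k hk => ?_
  rw [← Finset.prod_pow, Finset.filter_filter]
  have hk' : p k = i := by simpa using hk
  refine Finset.prod_congr (Finset.filter_congr fun m _ => ?_) fun m hm => ?_
  · exact ⟨fun h => ⟨by rw [h, hk'], h⟩, fun h => h.2⟩
  · rw [pow_mul, (Finset.mem_filter.1 hm).2.2]

theorem comp {p : κ → ι} {l : κ → ℕ} {p' : μ → κ} {l' : μ → ℕ} {F : ι → A} {φ : A →+* B}
    {s : κ → B} {φ' : B →+* D} {s' : μ → D} (h : IsUniversalFactorization p l F φ s)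
    (h' : IsUniversalFactorization p' l' s φ' s') :
    IsUniversalFactorization (fun m => p (p' m)) (fun m => l' m * l (p' m)) F (φ'.comp φ) s' where
  rel i := by
    rw [← Finset.prod_fiber_comp p p' l l']
    simp only [h'.rel, ← map_pow, ← map_prod, h.rel, RingHom.comp_apply]
  lift ψ c hc := by
    classical
    obtain ⟨χ, hχ, hχs⟩ := h.lift ψ (fun k => ∏ m with p' m = k, c m ^ l' m) fun i => by
      rw [← hc]
      exact Finset.prod_fiber_comp p p' l l' c i
    obtain ⟨χ', hχ', hχs'⟩ := h'.lift χ c fun k => (hχs k).symm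
    exact ⟨χ', by rw [← RingHom.comp_assoc, hχ', hχ], hχs'⟩
  ext χ χ' h₁ h₂ := by
    refine h'.ext _ _ (h.ext _ _ h₁ fun k => ?_) h₂
    simp only [RingHom.comp_apply, ← h'.rel, map_prod, map_pow, h₂]

theorem of_equiv {F : ι → A} [Fintype ι] (e : κ ≃ ι) :
    IsUniversalFactorization e (fun _ => 1) F (RingHom.id A) (fun k => F (e k)) where
  rel i := by
    classical
    rw [Finset.prod_eq_single (e.symm i)] <;> simp +contextual [← Equiv.eq_symm_apply]
  lift ψ c hc := ⟨ψ, by simp, fun k => by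
    classical
    rw [← hc, Finset.prod_eq_single k] <;> simp +contextual⟩
  ext χ χ' h _ := by simpa using h

open scoped Classical in
theorem split [Fintype ι] (F : ι → A) (j : ι) :
    IsUniversalFactorization (fun o : Option ι => o.getD j) (fun _ => 1) F (SplitRing.base (F j))
      (SplitRing.family F j) where
  rel i := by
    rw [Finset.prod_filter, Fintype.prod_option]
    by_cases h : j = i
    · subst h
      simp [SplitRing.family, SplitRing.left_mul_right]
    · simp [SplitRing.family, h, Ne.symm h]
  lift {C} _ ψ c hc := by
    have hc' : ∀ i, (if j = i then c none else 1) * c (some i) = ψ (F i) := fun i => by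
      rw [← hc, Finset.prod_filter, Fintype.prod_option]
      simp
    refine ⟨SplitRing.lift ψ (c none) (c (some j)) (by simpa using hc' j),
      SplitRing.lift_comp_base _ _ _ _, ?_⟩
    rintro (_ | i)
    · simp [SplitRing.family]
    · by_cases h : i = j
      · subst h
        simp [SplitRing.family]
      · simpa [SplitRing.family, h, Ne.symm h] using (hc' i).symm
  ext χ χ' h₁ h₂ :=
    SplitRing.hom_ext h₁ (h₂ none) (by simpa [SplitRing.family] using h₂ (some j))

end IsUniversalFactorization

theorem RadicalRegularFamily.comp_injective {A ι κ : Type*} [CommRing A] {F : ι → A}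
    (hF : RadicalRegularFamily F) {e : κ → ι} (he : Function.Injective e) :
    RadicalRegularFamily (fun k => F (e k)) :=
  ⟨hF.isDomain, hF.isIntegrallyClosed, fun _ => hF.ne_zero _, fun _ => hF.not_isUnit _,
    fun _ => hF.isRadical _, fun _ _ h => hF.regular _ _ (he.ne h)⟩

namespace HasRadicalFactorization

variable {K ι κ μ : Type} [CommRing K] [Fintype κ] [Fintype μ]

theorem comp {p : κ → ι} {l : κ → ℕ} {p' : μ → κ} {l' : μ → ℕ}
    (h : HasRadicalFactorization K p l) (h' : HasRadicalFactorization K p' l') :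
    HasRadicalFactorization K (fun m => p (p' m)) (fun m => l' m * l (p' m)) := by
  intro A _ η F hF
  obtain ⟨B, _, φ, s, hs, hu⟩ := h A η F hF
  obtain ⟨D, _, φ', s', hs', hu'⟩ := h' B (φ.comp η) s hs
  exact ⟨D, _, φ'.comp φ, s', hs', hu.comp hu'⟩

theorem of_equiv [Fintype ι] (e : κ ≃ ι) : HasRadicalFactorization K e (fun _ => 1) :=
  fun A _ _ _ hF => ⟨A, _, RingHom.id A, _, hF.comp_injective e.injective, .of_equiv e⟩

theorem split [Fintype ι] (j : ι) :
    HasRadicalFactorization K (fun o : Option ι => o.getD j) (fun _ => 1) :=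
  fun _ _ _ F hF => ⟨_, _, _, _, SplitRing.radicalRegularFamily hF j, .split F j⟩

theorem of_surjective_one [Fintype ι] (p : κ → ι) (hp : Function.Surjective p) :
    HasRadicalFactorization K p (fun _ => 1) := by
  classical
  induction hd : Fintype.card κ - Fintype.card ι generalizing ι with
  | zero =>
    have hcard : Fintype.card κ = Fintype.card ι :=
      le_antisymm (by omega) (Fintype.card_le_of_surjective p hp)
    exact of_equiv (Equiv.ofBijective p ((Fintype.bijective_iff_surjective_and_card p).2
      ⟨hp, hcard⟩))
  | succ d ih =>
    have hinj : ¬ Function.Injective p := fun h => by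
      have := Fintype.card_le_of_injective p h
      omega
    simp only [Function.Injective, not_forall] at hinj
    obtain ⟨k, k', hkk', hne⟩ := hinj
    let p' : κ → Option ι := fun x => if x = k then none else some (p x)
    have hp' : Function.Surjective p' := by
      rintro (_ | i)
      · exact ⟨k, by simp [p']⟩
      · obtain ⟨x, rfl⟩ := hp i
        by_cases hx : x = k
        · exact ⟨k', by simp [p', hx, Ne.symm hne, hkk']⟩
        · exact ⟨x, by simp [p', hx]⟩
    have h := (split (K := K) (p k)).comp (ih p' hp' (by rw [Fintype.card_option]; omega))
    have hpp : (fun x => (p' x).getD (p k)) = p := by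
      funext x
      by_cases hx : x = k <;> simp [p', hx]
    simpa only [hpp, mul_one] using h

end HasRadicalFactorization
end Solvable

section RootRing

/-- The ring `R[T] / (T ^ q - f)`. -/
abbrev RootRing {R : Type*} [CommRing R] (f : R) (q : ℕ) : Type _ :=
  AdjoinRoot (Polynomial.X ^ q - Polynomial.C f)

namespace RootRing

variable {R : Type*} [CommRing R] {f : R} {q : ℕ}

/-- The class of `T` in `R[T] / (T ^ q - f)`. -/
noncomputable abbrev root (f : R) (q : ℕ) : RootRing f q := AdjoinRoot.root _

/-- The structure map of `R[T] / (T ^ q - f)`. -/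
noncomputable abbrev of (f : R) (q : ℕ) : R →+* RootRing f q := AdjoinRoot.of _

/-- The class of a polynomial in `R[T] / (T ^ q - f)`. -/
noncomputable abbrev mk (f : R) (q : ℕ) : Polynomial R →+* RootRing f q := AdjoinRoot.mk _

theorem root_pow : root f q ^ q = of f q f := by
  have h := AdjoinRoot.eval₂_root (Polynomial.X ^ q - Polynomial.C f : Polynomial R)
  simpa [sub_eq_zero] using h

theorem mk_eq_sum {p : Polynomial R} (hp : p.degree < q) :
    mk f q p = ∑ m ∈ Finset.range q, of f q (p.coeff m) * root f q ^ m := by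
  rcases eq_or_ne p 0 with rfl | h
  · simp
  conv_lhs => rw [p.as_sum_range_C_mul_X_pow' ((Polynomial.natDegree_lt_iff_degree_lt h).2 hp)]
  simp

theorem exists_eq_mk (hq : q ≠ 0) (y : RootRing f q) :
    ∃ p : Polynomial R, p.degree < q ∧ y = mk f q p := by
  obtain ⟨p, rfl⟩ := AdjoinRoot.mk_surjective y
  rcases subsingleton_or_nontrivial R with h | h
  · refine ⟨p, ?_, rfl⟩
    rw [Polynomial.degree_of_subsingleton]
    exact WithBot.bot_lt_coe q
  refine ⟨p %ₘ (Polynomial.X ^ q - Polynomial.C f), ?_, ?_⟩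
  · refine (Polynomial.degree_modByMonic_lt p (Polynomial.monic_X_pow_sub_C f hq)).trans_eq ?_
    exact Polynomial.degree_X_pow_sub_C (Nat.pos_of_ne_zero hq) f
  · refine AdjoinRoot.mk_eq_mk.2 ⟨p /ₘ (Polynomial.X ^ q - Polynomial.C f), ?_⟩
    rw [sub_eq_iff_eq_add', Polynomial.modByMonic_add_div]

theorem eq_zero_of_mk_eq_zero (hq : q ≠ 0) {p : Polynomial R} (hp : p.degree < q)
    (h : mk f q p = 0) : p = 0 := by
  nontriviality R
  by_contra hne
  refine (Polynomial.monic_X_pow_sub_C f hq).not_dvd_of_degree_lt hne ?_ (AdjoinRoot.mk_eq_zero.1 h)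
  rwa [Polynomial.degree_X_pow_sub_C (Nat.pos_of_ne_zero hq)]

theorem of_dvd_mk_iff (hq : q ≠ 0) {c : R} {p : Polynomial R} (hp : p.degree < q) :
    of f q c ∣ mk f q p ↔ ∀ m, c ∣ p.coeff m := by
  rw [← Polynomial.C_dvd_iff_dvd_coeff]
  constructor
  · rintro ⟨y, hy⟩
    obtain ⟨p', hp', rfl⟩ := exists_eq_mk hq y
    refine ⟨p', sub_eq_zero.1 (eq_zero_of_mk_eq_zero (f := f) hq ?_ ?_)⟩
    · refine (Polynomial.degree_sub_le _ _).trans_lt (max_lt hp ?_)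
      refine lt_of_le_of_lt ?_ hp'
      rw [← Polynomial.smul_eq_C_mul]
      exact Polynomial.degree_smul_le _ _
    · rw [map_sub, hy, map_mul, mk, AdjoinRoot.mk_C, sub_self]
  · rintro ⟨p', rfl⟩
    exact ⟨mk f q p', by rw [map_mul, mk, AdjoinRoot.mk_C]⟩

theorem of_dvd_of_iff (hq : q ≠ 0) {c x : R} : of f q c ∣ of f q x ↔ c ∣ x := by
  have hC : (Polynomial.C x).degree < (q : WithBot ℕ) :=
    Polynomial.degree_C_le.trans_lt (by exact_mod_cast Nat.pos_of_ne_zero hq)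
  rw [of, ← AdjoinRoot.mk_C x, of_dvd_mk_iff hq hC]
  refine ⟨fun h => by simpa using h 0, fun h m => ?_⟩
  rw [Polynomial.coeff_C]
  split_ifs
  exacts [h, dvd_zero c]

theorem of_injective (hq : q ≠ 0) : Function.Injective (of f q) := by
  rw [injective_iff_map_eq_zero]
  intro x hx
  have : of f q 0 ∣ of f q x := by rw [hx, map_zero]
  exact zero_dvd_iff.1 ((of_dvd_of_iff hq).1 this)

/-- An additive subgroup stable under scalars from a field with a primitive `q`-th root of unity
and under the automorphisms over `R` is a graded subgroup. -/
theorem of_coeff_mul_root_pow_mem {K : Type*} [Field K] (η : K →+* R) (hq : (q : K) ≠ 0) {ζ : K}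
    (hζ : IsPrimitiveRoot ζ q) (P : AddSubgroup (RootRing f q))
    (hη : ∀ k, ∀ x ∈ P, of f q (η k) * x ∈ P)
    (hσ : ∀ σ : RootRing f q →+* RootRing f q, σ.comp (of f q) = of f q → ∀ x ∈ P, σ x ∈ P)
    {p : Polynomial R} (hp : p.degree < q) (h : mk f q p ∈ P) (m : ℕ) :
    of f q (p.coeff m) * root f q ^ m ∈ P := by
  rcases le_or_gt q m with hm | hm
  · rw [Polynomial.coeff_eq_zero_of_degree_lt (hp.trans_le (by exact_mod_cast hm)), map_zero,
      zero_mul]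
    exact P.zero_mem
  let σ : ℕ → RootRing f q →+* RootRing f q := fun k =>
    AdjoinRoot.lift (of f q) (of f q (η (ζ ^ k)) * root f q) (by
      rw [Polynomial.eval₂_sub, Polynomial.eval₂_pow, Polynomial.eval₂_X, Polynomial.eval₂_C,
        mul_pow, root_pow, ← map_pow, ← map_pow, ← pow_mul, mul_comm k, pow_mul, hζ.pow_eq_one]
      simp)
  have hσk : ∀ k, (σ k).comp (of f q) = of f q := fun k => by ext; simp [σ]
  have hmem : ∑ k ∈ Finset.range q, of f q (η ((ζ ^ (q - m)) ^ k)) * σ k (mk f q p) ∈ P :=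
    P.sum_mem fun k _ => hη _ _ (hσ _ (hσk k) _ h)
  have hgeom : ∀ n ∈ Finset.range q, ∑ k ∈ Finset.range q, (ζ ^ (q - m + n)) ^ k =
      if n = m then (q : K) else 0 := by
    intro n hn
    rw [Finset.mem_range] at hn
    split_ifs with hnm
    · subst hnm
      simp [Nat.sub_add_cancel hn.le, hζ.pow_eq_one]
    · have hne : ζ ^ (q - m + n) ≠ 1 := by
        rw [Ne, hζ.pow_eq_one_iff_dvd]
        rintro ⟨d, hd⟩
        have h0 : d ≠ 0 := by rintro rfl; omega
        have h2 : d < 2 := by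
          by_contra! hcon
          have := Nat.mul_le_mul_left q hcon
          omega
        obtain rfl : d = 1 := by omega
        omega
      rw [geom_sum_eq hne, ← pow_mul, mul_comm, pow_mul, hζ.pow_eq_one]
      simp
  have hsum : ∑ k ∈ Finset.range q, of f q (η ((ζ ^ (q - m)) ^ k)) * σ k (mk f q p) =
      of f q (η q) * (of f q (p.coeff m) * root f q ^ m) := by
    have h1 : ∀ k, of f q (η ((ζ ^ (q - m)) ^ k)) * σ k (mk f q p) =
        ∑ n ∈ Finset.range q, of f q (η ((ζ ^ (q - m + n)) ^ k)) *
          (of f q (p.coeff n) * root f q ^ n) := fun k => by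
      rw [mk_eq_sum hp, map_sum, Finset.mul_sum]
      refine Finset.sum_congr rfl fun n _ => ?_
      simp only [σ, map_mul, map_pow, AdjoinRoot.lift_of, AdjoinRoot.lift_root, pow_add, mul_pow]
      ring
    simp only [h1]
    rw [Finset.sum_comm]
    simp only [← Finset.sum_mul, ← map_sum]
    rw [Finset.sum_eq_single m]
    · rw [hgeom m (Finset.mem_range.2 hm), if_pos rfl]
    · intro n hn hnm
      rw [hgeom n hn, if_neg hnm, map_zero, map_zero, zero_mul]
    · intro hm'
      exact absurd (Finset.mem_range.2 hm) hm'
  rw [hsum] at hmem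
  have := hη (q : K)⁻¹ _ hmem
  rwa [← mul_assoc, ← map_mul, ← map_mul, inv_mul_cancel₀ hq, map_one, map_one, one_mul] at this

theorem isRadical_of {K : Type*} [Field K] (η : K →+* R) (hq : (q : K) ≠ 0) {ζ : K}
    (hζ : IsPrimitiveRoot ζ q) {c : R} (hc : IsRadical c) (hcf : ∀ x, c ∣ f * x → c ∣ x) :
    IsRadical (of f q c) := by
  have hq' : q ≠ 0 := by rintro rfl; simp at hq
  intro N y hy
  obtain ⟨p, hp, rfl⟩ := exists_eq_mk hq' y
  rw [of_dvd_mk_iff hq' hp]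
  intro m
  have hm : of f q (p.coeff m) * root f q ^ m ∈ (Ideal.span {of f q c}).radical := by
    refine of_coeff_mul_root_pow_mem η hq hζ
      (Submodule.toAddSubgroup (Ideal.span {of f q c}).radical) (fun k x hx => ?_)
      (fun σ hσ x hx => ?_) hp ?_ m
    · exact Ideal.mul_mem_left _ _ hx
    · obtain ⟨n, hn⟩ := hx
      rw [Ideal.mem_span_singleton] at hn
      refine ⟨n, Ideal.mem_span_singleton.2 ?_⟩
      have := map_dvd σ hn
      rwa [map_pow, ← RingHom.comp_apply, hσ] at this
    · exact ⟨N, Ideal.mem_span_singleton.2 hy⟩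
  obtain ⟨n, hn⟩ := hm
  rw [Ideal.mem_span_singleton] at hn
  have h1 : of f q c ∣ of f q (f ^ (m * n) * p.coeff m ^ (n * q)) := by
    refine (hn.trans (dvd_pow_self _ hq')).trans (dvd_of_eq ?_)
    rw [map_mul, map_pow, map_pow, ← root_pow]
    ring
  exact hc _ _ (dvd_of_dvd_pow_mul hcf _ _ ((of_dvd_of_iff hq').1 h1))

/-- The reduction of `R[T] / (T ^ q - f)` modulo `T`. -/
noncomputable def modRoot (f : R) (hq : q ≠ 0) : RootRing f q →+* R ⧸ Ideal.span {f} :=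
  AdjoinRoot.lift (Ideal.Quotient.mk _) 0 (by
    simp [hq, dvd_iff_quotient_mk_eq_zero.1 (dvd_refl f)])

theorem root_dvd_iff (hq : q ≠ 0) (y : RootRing f q) : root f q ∣ y ↔ modRoot f hq y = 0 := by
  constructor
  · rintro ⟨z, rfl⟩
    simp [modRoot]
  · intro h
    obtain ⟨p, rfl⟩ := AdjoinRoot.mk_surjective y
    rw [← p.divX_mul_X_add] at h ⊢
    have h0 : Ideal.Quotient.mk (Ideal.span {f}) (p.coeff 0) = 0 := by
      simpa [modRoot] using h
    rw [← dvd_iff_quotient_mk_eq_zero] at h0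
    rw [map_add, map_mul, AdjoinRoot.mk_X, AdjoinRoot.mk_C]
    refine dvd_add (dvd_mul_left _ _) (dvd_trans ?_ (map_dvd _ h0))
    rw [← root_pow]
    exact dvd_pow_self _ hq

/-- The base change of `R[T] / (T ^ q - f)` along a ring homomorphism. -/
noncomputable def map {S : Type*} [CommRing S] (φ : R →+* S) (f : R) (q : ℕ) :
    RootRing f q →+* RootRing (φ f) q :=
  AdjoinRoot.map φ _ _ (by simp)

theorem map_mk {S : Type*} [CommRing S] (φ : R →+* S) (p : Polynomial R) :
    map φ f q (mk f q p) = mk (φ f) q (p.map φ) := by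
  induction p using Polynomial.induction_on' with
  | add p p' h h' => simp only [map_add, Polynomial.map_add, h, h']
  | monomial n a => simp [← Polynomial.C_mul_X_pow_eq_monomial, map]

theorem map_injective {S : Type*} [CommRing S] {φ : R →+* S} (hφ : Function.Injective φ)
    (hq : q ≠ 0) : Function.Injective (map φ f q) := by
  rw [injective_iff_map_eq_zero]
  intro y hy
  obtain ⟨p, hp, rfl⟩ := exists_eq_mk hq y
  rw [map_mk] at hy
  rw [(Polynomial.map_eq_zero_iff hφ).1
    (eq_zero_of_mk_eq_zero hq (Polynomial.degree_map_le.trans_lt hp) hy), map_zero]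

section Normal

variable [IsDomain R] [IsIntegrallyClosed R]

theorem irreducible_X_pow_sub_C (hq : q.Prime) (hf : f ≠ 0) (hu : ¬ IsUnit f) (hr : IsRadical f) :
    Irreducible (Polynomial.X ^ q - Polynomial.C (algebraMap R (FractionRing R) f)) := by
  refine X_pow_sub_C_irreducible_of_prime hq fun b hb => ?_
  obtain ⟨b, rfl⟩ := IsIntegrallyClosed.exists_algebraMap_eq_of_isIntegral_pow hq.pos
    (by rw [hb]; exact isIntegral_algebraMap)
  rw [← map_pow, (IsFractionRing.injective R (FractionRing R)).eq_iff] at hb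
  obtain ⟨c, rfl⟩ := hr q b (dvd_of_eq hb.symm)
  refine hu (IsUnit.of_mul_eq_one (f ^ (q - 2) * c ^ q) (mul_left_cancel₀ hf ?_))
  conv_rhs => rw [mul_one, ← hb, mul_pow]
  obtain ⟨k, rfl⟩ := Nat.exists_eq_add_of_le hq.two_le
  rw [Nat.add_sub_cancel_left]
  ring

theorem isDomain (hq : q.Prime) (hf : f ≠ 0) (hu : ¬ IsUnit f) (hr : IsRadical f) :
    IsDomain (RootRing f q) := by
  have : Fact (Irreducible _) := ⟨irreducible_X_pow_sub_C hq hf hu hr⟩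
  exact (map_injective (f := f) (IsFractionRing.injective R (FractionRing R)) hq.ne_zero).isDomain

theorem exists_algebraMap_eq_of_isIntegral (hf : f ≠ 0) (hr : IsRadical f) {m : ℕ} (hm : m < q)
    {a : FractionRing R} (ha : IsIntegral R (a ^ q * algebraMap R (FractionRing R) f ^ m)) :
    ∃ b, algebraMap R (FractionRing R) b = a := by
  set φ := algebraMap R (FractionRing R)
  have hφ : Function.Injective φ := IsFractionRing.injective R (FractionRing R)
  obtain ⟨d, hd⟩ := IsIntegrallyClosed.isIntegral_iff.1 ha
  have h1 : (a * φ f) ^ q = φ (d * f ^ (q - m)) := by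
    rw [map_mul, hd, map_pow, mul_pow, mul_assoc, ← pow_add, Nat.add_sub_cancel' hm.le]
  obtain ⟨e, he⟩ := IsIntegrallyClosed.exists_algebraMap_eq_of_isIntegral_pow (R := R)
    (x := a * φ f) (n := q) (by omega) (by rw [h1]; exact isIntegral_algebraMap)
  rw [← he, ← map_pow] at h1
  obtain ⟨b, rfl⟩ := hr q e (by
    rw [hφ h1]
    exact Dvd.dvd.mul_left (dvd_pow_self f (by omega)) _)
  refine ⟨b, mul_right_cancel₀ ((map_ne_zero_iff φ hφ).2 hf) ?_⟩
  rw [← he, map_mul, mul_comm]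

theorem isIntegrallyClosed {K : Type*} [Field K] (η : K →+* R) (hqK : (q : K) ≠ 0) {ζ : K}
    (hζ : IsPrimitiveRoot ζ q) (hq : q.Prime) (hf : f ≠ 0) (hu : ¬ IsUnit f) (hr : IsRadical f) :
    IsIntegrallyClosed (RootRing f q) := by
  set φ := algebraMap R (FractionRing R)
  have hφ : Function.Injective φ := IsFractionRing.injective R (FractionRing R)
  have : Fact (Irreducible (Polynomial.X ^ q - Polynomial.C (φ f))) :=
    ⟨irreducible_X_pow_sub_C hq hf hu hr⟩
  let L := RootRing (φ f) q
  have : FiniteDimensional (FractionRing R) L :=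
    (Polynomial.monic_X_pow_sub_C (φ f) hq.ne_zero).finite_adjoinRoot
  have hcl : IsIntegrallyClosed (integralClosure R L) :=
    integralClosure.isIntegrallyClosedOfFiniteExtension (FractionRing R)
  have hmem : ∀ y, map φ f q y ∈ integralClosure R L := by
    intro y
    obtain ⟨p, rfl⟩ := AdjoinRoot.mk_surjective y
    induction p using Polynomial.induction_on' with
    | add p p' h h' => rw [map_add, map_add]; exact add_mem h h'
    | monomial n a =>
      rw [map_mk, Polynomial.map_monomial, ← Polynomial.C_mul_X_pow_eq_monomial, map_mul, map_pow,
        mk, AdjoinRoot.mk_C, AdjoinRoot.mk_X]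
      refine mul_mem (isIntegral_algebraMap (R := R) (A := L) (x := a)) (pow_mem ?_ n)
      refine IsIntegral.of_pow hq.pos ?_
      rw [root_pow]
      exact isIntegral_algebraMap (R := R) (A := L) (x := f)
  refine @IsIntegrallyClosed.of_equiv _ _ _ _ (RingEquiv.ofBijective
    (RingHom.codRestrict (map φ f q) (integralClosure R L) hmem) ⟨?_, ?_⟩).symm hcl
  · intro x y hxy
    exact map_injective hφ hq.ne_zero (congrArg Subtype.val hxy)
  · rintro ⟨x, hx⟩
    obtain ⟨p, hp, rfl⟩ := exists_eq_mk hq.ne_zero x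
    have hcomp := of_coeff_mul_root_pow_mem (φ.comp η) hqK hζ
      (integralClosure R L).toSubring.toAddSubgroup
      (fun k x hx => (integralClosure R L).mul_mem (isIntegral_algebraMap (R := R) (A := L) (x := η k)) hx)
      (fun σ hσ x hx => IsIntegral.map (⟨σ, fun a => RingHom.congr_fun hσ (φ a)⟩ : L →ₐ[R] L) hx)
      hp hx
    have hcoeff : ∀ m, ∃ b, φ b = p.coeff m := by
      intro m
      rcases le_or_gt q m with hm | hm
      · exact ⟨0, by rw [map_zero, Polynomial.coeff_eq_zero_of_degree_lt
          (hp.trans_le (by exact_mod_cast hm))]⟩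
      refine exists_algebraMap_eq_of_isIntegral hf hr hm ?_
      have h1 : IsIntegral R ((of (φ f) q (p.coeff m) * root (φ f) q ^ m) ^ q) :=
        IsIntegral.pow (hcomp m) q
      have h2 : (of (φ f) q (p.coeff m) * root (φ f) q ^ m) ^ q =
          algebraMap (FractionRing R) L (p.coeff m ^ q * φ f ^ m) := by
        change _ = of (φ f) q _
        rw [map_mul, map_pow, map_pow, ← root_pow]
        ring
      rw [h2] at h1
      exact (isIntegral_algebraMap_iff (algebraMap (FractionRing R) L).injective).1 h1
    choose b hb using hcoeff
    refine ⟨mk f q (∑ m ∈ Finset.range q, Polynomial.C (b m) * Polynomial.X ^ m),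
      Subtype.ext ?_⟩
    change map φ f q _ = mk (φ f) q p
    rw [map_mk, mk_eq_sum hp]
    simp [Polynomial.map_sum, hb]

end Normal

end RootRing
end RootRing

section RootFamily

namespace RootRing

open scoped Classical in
/-- The family obtained by replacing the member `F j` by a `q`-th root of it. -/
noncomputable def family {A ι : Type*} [CommRing A] (F : ι → A) (j : ι) (q : ℕ) (i : ι) :
    RootRing (F j) q :=
  if i = j then root (F j) q else of (F j) q (F i)

theorem radicalRegularFamily {A ι K : Type*} [CommRing A] [Field K] (η : K →+* A) {F : ι → A}
    (hF : RadicalRegularFamily F) (j : ι) {q : ℕ} (hqK : (q : K) ≠ 0) {ζ : K}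
    (hζ : IsPrimitiveRoot ζ q) (hq : q.Prime) : RadicalRegularFamily (family F j q) := by
  have := hF.isDomain
  have := hF.isIntegrallyClosed
  have hq0 := hq.ne_zero
  have hj := hF.ne_zero j
  have hD : IsDomain (RootRing (F j) q) := isDomain hq hj (hF.not_isUnit j) (hF.isRadical j)
  have hred := (hF.isRadical j).isReduced_quotient_span
  have hnt := nontrivial_quotient_span (hF.not_isUnit j)
  have hof : ∀ i, of (F j) q (F i) ≠ 0 := fun i =>
    (map_ne_zero_iff _ (of_injective hq0)).2 (hF.ne_zero i)
  have hroot : root (F j) q ≠ 0 := by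
    intro h
    apply hof j
    rw [← root_pow, h, zero_pow hq0]
  have hrb : ∀ i, i ≠ j → ∀ x, root (F j) q ∣ of (F j) q (F i) * x → root (F j) q ∣ x :=
    fun i hi => dvd_of_dvd_mul_of_ker _ (root_dvd_iff hq0) (by
      rw [modRoot, AdjoinRoot.lift_of]
      exact quotient_mk_mem_nonZeroDivisors (hF.regular j i hi.symm))
  refine ⟨hD, isIntegrallyClosed η hqK hζ hq hj (hF.not_isUnit j) (hF.isRadical j), ?_, ?_, ?_, ?_⟩
  · intro i
    rw [family]
    split_ifs
    exacts [hroot, hof i]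
  · intro i
    rw [family]
    split_ifs with hi
    · exact not_isUnit_of_ker _ (root_dvd_iff hq0)
    · rw [isUnit_iff_dvd_one, ← map_one (of (F j) q), of_dvd_of_iff hq0, ← isUnit_iff_dvd_one]
      exact hF.not_isUnit i
  · intro i
    rw [family]
    split_ifs with hi
    · exact isRadical_of_ker _ (root_dvd_iff hq0)
    · exact isRadical_of η hqK hζ (hF.isRadical i) (hF.regular i j hi)
  · intro i k hik
    by_cases hi : i = j
    · have hk : k ≠ j := fun h => hik (hi.trans h.symm)
      simpa [family, hi, hk] using hrb k hk
    · by_cases hk : k = j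
      · simpa [family, hi, hk] using regular_symm hroot (hrb i hi)
      · simp only [family, hi, hk, if_false]
        intro x hx
        obtain ⟨p, hp, rfl⟩ := exists_eq_mk hq0 x
        have hkp : of (F j) q (F k) * mk (F j) q p = mk (F j) q (F k • p) := by
          rw [Polynomial.smul_eq_C_mul, map_mul, mk, AdjoinRoot.mk_C]
        rw [hkp, of_dvd_mk_iff hq0 ((Polynomial.degree_smul_le _ _).trans_lt hp)] at hx
        rw [of_dvd_mk_iff hq0 hp]
        exact fun m => hF.regular i k hik _ (by simpa using hx m)

end RootRing

open scoped Classical in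
theorem IsUniversalFactorization.root {A ι : Type} [CommRing A] [Fintype ι] (F : ι → A) (j : ι)
    (q : ℕ) : IsUniversalFactorization id (Function.update 1 j q) F (RootRing.of (F j) q)
      (RootRing.family F j q) where
  rel i := by
    have : (Finset.univ.filter fun k : ι => id k = i) = {i} := by ext; simp
    rw [this, Finset.prod_singleton, RootRing.family]
    split_ifs with h
    · subst h
      rw [Function.update_self, RootRing.root_pow]
    · simp [Function.update_of_ne h]
  lift {C} _ ψ c hc := by
    have hc' : ∀ i, c i ^ Function.update (1 : ι → ℕ) j q i = ψ (F i) := fun i => by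
      have : (Finset.univ.filter fun k : ι => id k = i) = {i} := by ext; simp
      rw [← hc i, this, Finset.prod_singleton]
    refine ⟨AdjoinRoot.lift ψ (c j) ?_, ?_, fun i => ?_⟩
    · have := hc' j
      rw [Function.update_self] at this
      simp [this]
    · ext; simp
    · rw [RootRing.family]
      split_ifs with h
      · rw [h, AdjoinRoot.lift_root]
      · rw [AdjoinRoot.lift_of, ← hc' i, Function.update_of_ne h, Pi.one_apply, pow_one]
  ext χ χ' h₁ h₂ :=
    AdjoinRoot.ringHom_ext h₁ (by simpa [RootRing.family] using h₂ j)

namespace HasRadicalFactorization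

variable {K ι κ : Type} [Field K] [IsAlgClosed K] [CharZero K] [Fintype ι] [Fintype κ]

open scoped Classical in
theorem root (j : ι) {n : ℕ} (hn : n ≠ 0) :
    HasRadicalFactorization K (id : ι → ι) (Function.update 1 j n) := by
  induction n using induction_on_primes with
  | zero => exact absurd rfl hn
  | one =>
    have h := of_equiv (K := K) (Equiv.refl ι)
    rwa [Function.update_eq_self_iff.2 (Pi.one_apply j).symm]
  | prime_mul q n hq ih =>
    have hq' : HasRadicalFactorization K (id : ι → ι) (Function.update 1 j q) := by
      intro A _ η F hF
      have : NeZero (q : K) := ⟨by exact_mod_cast hq.ne_zero⟩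
      obtain ⟨ζ, hζ⟩ := HasEnoughRootsOfUnity.exists_primitiveRoot K q
      exact ⟨_, _, _, _, RootRing.radicalRegularFamily η hF j (NeZero.ne _) hζ hq, .root F j q⟩
    have h := (ih (right_ne_zero_of_mul hn)).comp hq'
    convert h using 1
    · rfl
    funext i
    by_cases hi : i = j
    · subst hi; simp
    · simp [Function.update_of_ne hi]

theorem of_id (l : ι → ℕ) (hl : ∀ i, l i ≠ 0) : HasRadicalFactorization K (id : ι → ι) l := by
  classical
  have key : ∀ s : Finset ι,
      HasRadicalFactorization K (id : ι → ι) (fun i => if i ∈ s then l i else 1) := by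
    intro s
    induction s using Finset.induction_on with
    | empty => simpa using of_equiv (K := K) (Equiv.refl ι)
    | insert j s hj ih =>
      have h := ih.comp (root (K := K) j (hl j))
      convert h using 1
      · rfl
      funext i
      by_cases hi : i = j
      · subst hi; simp [hj]
      · simp [hi]
  simpa using key Finset.univ

theorem of_surjective {p : κ → ι} (hp : Function.Surjective p) (l : κ → ℕ) (hl : ∀ k, l k ≠ 0) :
    HasRadicalFactorization K p l := by
  simpa using (of_surjective_one (K := K) p hp).comp (of_id l hl)

end HasRadicalFactorization

end RootFamily

section LinearForms

variable {K : Type*} [Field K]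

/-- The linear form with coefficients `a` in two variables. -/
noncomputable def linearForm (a : K × K) : MvPolynomial (Fin 2) K := C a.1 * X 0 + C a.2 * X 1

theorem irreducible_linearForm {a : K × K} (ha : a ≠ 0) : Irreducible (linearForm a) := by
  have h0 : (linearForm a).coeff (Finsupp.single 0 1) = a.1 := by
    simp [linearForm, coeff_C_mul, coeff_X, Finsupp.single_left_inj]
  have h1 : (linearForm a).coeff (Finsupp.single 1 1) = a.2 := by
    simp [linearForm, coeff_C_mul, coeff_X, Finsupp.single_left_inj]
  have hhom : (linearForm a).IsHomogeneous 1 :=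
    ((isHomogeneous_X _ _).C_mul _).add ((isHomogeneous_X _ _).C_mul _)
  have hne : linearForm a ≠ 0 := by
    intro h
    rw [h] at h0 h1
    exact ha (Prod.ext (by simpa using h0.symm) (by simpa using h1.symm))
  refine irreducible_of_totalDegree_eq_one (hhom.totalDegree hne) fun x hx => ?_
  refine isUnit_iff_ne_zero.2 ?_
  rintro rfl
  exact hne (MvPolynomial.ext _ _ fun m => by simpa using hx m)

theorem radicalRegularFamily_linearForm {ι : Type*} {a : ι → K × K}
    (ha : ∀ i k, i ≠ k → (a i).1 * (a k).2 - (a k).1 * (a i).2 ≠ 0) (h0 : ∀ i, a i ≠ 0) :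
    RadicalRegularFamily fun i => linearForm (a i) := by
  have hp : ∀ i, Prime (linearForm (a i)) := fun i => (irreducible_linearForm (h0 i)).prime
  refine ⟨inferInstance, inferInstance, fun i => (hp i).ne_zero, fun i => (hp i).not_isUnit,
    fun i => (hp i).isRadical, fun i k hik x hx => ((hp i).dvd_or_dvd hx).resolve_left fun h => ?_⟩
  have := map_dvd (eval ![(a i).2, -(a i).1]) h
  simp only [linearForm, map_add, map_mul, eval_C, eval_X] at this
  refine ha i k hik ?_
  have h2 := zero_dvd_iff.1 ((dvd_of_eq (by simp; ring)).trans this)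
  simp at h2
  linear_combination -h2

end LinearForms

section LinearRelations

theorem alpha_ne_zero (𝕂 : Type) [Field 𝕂] {r : ℕ} {a : Fin (r + 1) → 𝕂 × 𝕂} {i k : Fin (r + 1)}
    (h : LinearIndependent 𝕂 ![a i, a k]) : alpha 𝕂 r a i k ≠ 0 := by
  intro h0
  rw [LinearIndependent.pair_iff] at h
  rw [alpha] at h0
  have h1 := h (a k).1 (-(a i).1) (by
    ext
    · simp [mul_comm]
    · simp; linear_combination -h0)
  have h2 := h (a k).2 (-(a i).2) (by
    ext
    · simp; linear_combination h0
    · simp [mul_comm])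
  have h3 := h 1 0 (by
    ext
    · simpa using h1.2
    · simpa using h2.2)
  exact one_ne_zero h3.1

theorem exists_eq_linear_of_relations (𝕂 : Type) [Field 𝕂] {r : ℕ} (hr : 1 ≤ r)
    {a : Fin (r + 1) → 𝕂 × 𝕂} (ha : ∀ i k, i ≠ k → alpha 𝕂 r a i k ≠ 0) {S : Type*} [CommRing S]
    (c : 𝕂 →+* S) (M : Fin (r + 1) → S)
    (hM : ∀ i j k : Fin (r + 1), (j : ℕ) = (i : ℕ) + 1 → (k : ℕ) = (i : ℕ) + 2 →
      c (alpha 𝕂 r a j k) * M i + c (alpha 𝕂 r a k i) * M j + c (alpha 𝕂 r a i j) * M k = 0) :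
    ∃ u v, ∀ i, M i = c (a i).1 * u + c (a i).2 * v := by
  let i₁ : Fin (r + 1) := ⟨1, by omega⟩
  have h01 : alpha 𝕂 r a 0 i₁ ≠ 0 := ha _ _ fun h => by simpa [i₁] using congrArg Fin.val h
  have hinv : c (alpha 𝕂 r a 0 i₁)⁻¹ * c (alpha 𝕂 r a 0 i₁) = 1 := by
    rw [← map_mul, inv_mul_cancel₀ h01, map_one]
  set δ := c (alpha 𝕂 r a 0 i₁)⁻¹
  simp only [alpha, map_sub, map_mul] at hinv hM
  let u := δ * (c (a i₁).2 * M 0 - c (a 0).2 * M i₁)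
  let v := δ * (c (a 0).1 * M i₁ - c (a i₁).1 * M 0)
  refine ⟨u, v, ?_⟩
  have key : ∀ n (hn : n < r + 1),
      M ⟨n, hn⟩ = c (a ⟨n, hn⟩).1 * u + c (a ⟨n, hn⟩).2 * v := by
    intro n
    induction n using Nat.strong_induction_on with
    | _ n ih =>
      intro hn
      rcases n with _ | _ | n
      · change M 0 = c (a 0).1 * u + c (a 0).2 * v
        simp only [u, v]
        linear_combination -(M 0) * hinv
      · change M i₁ = c (a i₁).1 * u + c (a i₁).2 * v
        simp only [u, v]
        linear_combination -(M i₁) * hinv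
      · have hrel := hM ⟨n, by omega⟩ ⟨n + 1, by omega⟩ ⟨n + 2, hn⟩ rfl rfl
        rw [ih n (by omega) (by omega), ih (n + 1) (by omega) (by omega)] at hrel
        have hα : alpha 𝕂 r a ⟨n, by omega⟩ ⟨n + 1, by omega⟩ ≠ 0 :=
          ha _ _ fun h => by simpa using congrArg Fin.val h
        have hu : IsUnit (c (alpha 𝕂 r a ⟨n, by omega⟩ ⟨n + 1, by omega⟩)) :=
          (isUnit_iff_ne_zero.2 hα).map c
        refine hu.mul_left_cancel ?_
        simp only [alpha, map_sub, map_mul]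
        linear_combination hrel
  exact fun i => key i i.2

theorem relation_linear (𝕂 : Type) [Field 𝕂] {r : ℕ} (a : Fin (r + 1) → 𝕂 × 𝕂)
    (i j k : Fin (r + 1)) :
    C (alpha 𝕂 r a j k) * linearForm (a i) + C (alpha 𝕂 r a k i) * linearForm (a j) +
      C (alpha 𝕂 r a i j) * linearForm (a k) = 0 := by
  simp only [alpha, linearForm, map_sub, map_mul]
  ring

/-- A ring homomorphism out of `𝕂[u, v]` is determined by its values on scalars and on two
independent linear forms. -/
theorem ringHom_ext_linearForm {𝕂 : Type} [Field 𝕂] {S : Type*} [CommRing S]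
    {χ χ' : MvPolynomial (Fin 2) 𝕂 →+* S} {x y : 𝕂 × 𝕂} (h : x.1 * y.2 - y.1 * x.2 ≠ 0)
    (hC : ∀ k, χ (C k) = χ' (C k)) (hx : χ (linearForm x) = χ' (linearForm x))
    (hy : χ (linearForm y) = χ' (linearForm y)) : χ = χ' := by
  have hu : IsUnit (χ' (C (x.1 * y.2 - y.1 * x.2))) :=
    ((isUnit_iff_ne_zero.2 h).map C).map χ'
  simp only [linearForm, map_add, map_mul, hC] at hx hy
  refine ringHom_ext hC fun i => hu.mul_left_cancel ?_
  simp only [map_sub, map_mul]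
  fin_cases i
  · simp only [Fin.zero_eta]
    linear_combination χ' (C y.2) * hx - χ' (C x.2) * hy
  · simp only [Fin.mk_one]
    linear_combination χ' (C x.1) * hy - χ' (C y.1) * hx

end LinearRelations

section Presentation

theorem prod_filter_sigma_fst {r : ℕ} {n : Fin (r + 1) → ℕ} {S : Type*} [CommMonoid S]
    (c : Idx r n → S) (i : Fin (r + 1)) [DecidablePred fun k : Idx r n => k.1 = i] :
    ∏ k : Idx r n with k.1 = i, c k = ∏ j, c ⟨i, j⟩ := by
  rw [Finset.prod_filter, Fintype.prod_sigma, Finset.prod_eq_single i]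
  · simp
  · intro k _ hk
    simp [hk]
  · simp

theorem IsUniversalFactorization.nonempty_ringEquiv (𝕂 : Type) [Field 𝕂] {r : ℕ} (hr : 1 ≤ r)
    {a : Fin (r + 1) → 𝕂 × 𝕂} (ha : ∀ i k, i ≠ k → alpha 𝕂 r a i k ≠ 0)
    {n : Fin (r + 1) → ℕ} {l : ∀ i : Fin (r + 1), Fin (n i) → ℕ} {B : Type} [CommRing B]
    {φ : MvPolynomial (Fin 2) 𝕂 →+* B} {s : Idx r n → B}
    (h : IsUniversalFactorization (fun k : Idx r n => k.1) (fun k => l k.1 k.2)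
      (fun i => linearForm (a i)) φ s) :
    Nonempty (B ≃+* RAnL 𝕂 r a n l) := by
  classical
  set π := Ideal.Quotient.mk (relIdeal 𝕂 r a n l)
  have hrel := h.rel
  simp only [prod_filter_sigma_fst] at hrel
  have hθ : ∀ x ∈ relIdeal 𝕂 r a n l, eval₂Hom (φ.comp C) s x = 0 := by
    intro x hx
    refine (Ideal.span_le (I := RingHom.ker (eval₂Hom (φ.comp C) s))).2 ?_ hx
    rintro _ ⟨i, j, k, -, -, rfl⟩
    have hmono : ∀ i, eval₂Hom (φ.comp C) s (mono 𝕂 r n l i) = φ (linearForm (a i)) :=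
      fun i => by simp [mono, ← hrel]
    rw [SetLike.mem_coe, RingHom.mem_ker, gPoly]
    simp only [map_add, map_mul, hmono, eval₂Hom_C, RingHom.comp_apply]
    rw [← map_mul, ← map_mul, ← map_mul, ← map_add, ← map_add, relation_linear, map_zero]
  let θ : RAnL 𝕂 r a n l →+* B := Ideal.Quotient.lift _ (eval₂Hom (φ.comp C) s) hθ
  have hθC : ∀ k, θ (π (C k)) = φ (C k) := fun k => by simp [θ, π]
  have hθX : ∀ k, θ (π (X k)) = s k := fun k => by simp [θ, π]
  obtain ⟨u, v, huv⟩ := exists_eq_linear_of_relations 𝕂 hr ha (π.comp C)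
    (fun i => π (mono 𝕂 r n l i)) fun i j k hij hik => by
      rw [RingHom.comp_apply, RingHom.comp_apply, RingHom.comp_apply, ← map_mul, ← map_mul,
        ← map_mul, ← map_add, ← map_add]
      exact Ideal.Quotient.eq_zero_iff_mem.2 (Ideal.subset_span ⟨i, j, k, hij, hik, rfl⟩)
  obtain ⟨χ, hχ, hχs⟩ := h.lift (eval₂Hom (π.comp C) ![u, v]) (fun k => π (X k)) fun i => by
    rw [prod_filter_sigma_fst fun k : Idx r n => π (X k) ^ l k.1 k.2]
    have := huv i
    simp only [mono, map_prod, map_pow] at this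
    rw [this]
    simp [linearForm]
  have hχC : ∀ k, χ (φ (C k)) = π (C k) := fun k => by
    rw [← RingHom.comp_apply, hχ]
    simp
  have hs : ∀ k, θ (χ (s k)) = s k := fun k => by rw [hχs, hθX]
  have hl : ∀ i, θ (χ (φ (linearForm (a i)))) = φ (linearForm (a i)) := fun i => by
    simp only [← hrel, map_prod, map_pow, hs]
  refine ⟨RingEquiv.ofRingHom χ θ ?_ ?_⟩
  · refine Ideal.Quotient.ringHom_ext (ringHom_ext (fun k => ?_) fun k => ?_)
    · simp only [RingHom.comp_apply]
      change χ (θ (π (C k))) = π (C k)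
      rw [hθC, hχC]
    · change χ (θ (π (X k))) = π (X k)
      rw [hθX, hχs]
  · refine h.ext _ _ ?_ hs
    refine ringHom_ext_linearForm (ha 0 ⟨1, by omega⟩ fun h => ?_) (fun k => ?_) (hl _) (hl _)
    · simpa using congrArg Fin.val h
    · simp only [RingHom.comp_apply, RingHom.id_apply, hχC, hθC]

end Presentation

section Statement2

/-- `R(A,𝔫,L)` is a normal domain: it is an integral domain which is integrally closed
in its field of fractions. -/
theorem statement2 (𝕂 : Type) [Field 𝕂] [IsAlgClosed 𝕂] [CharZero 𝕂]
    (r : ℕ) (hr : 1 ≤ r) (a : Fin (r+1) → 𝕂 × 𝕂)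
    (ha : ∀ i k : Fin (r+1), i ≠ k → LinearIndependent 𝕂 ![a i, a k])
    (n : Fin (r+1) → ℕ) (hn : ∀ i, 0 < n i)
    (l : ∀ i : Fin (r+1), Fin (n i) → ℕ) (hl : ∀ i j, 0 < l i j) :
    IsDomain (RAnL 𝕂 r a n l) ∧ IsIntegrallyClosed (RAnL 𝕂 r a n l) := by
  have hα : ∀ i k, i ≠ k → alpha 𝕂 r a i k ≠ 0 := fun i k hik => alpha_ne_zero 𝕂 (ha i k hik)
  have h0 : ∀ i, a i ≠ 0 := fun i => by
    obtain ⟨k, hk⟩ : ∃ k, i ≠ k := by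
      have : Nontrivial (Fin (r + 1)) := Fin.nontrivial_iff_two_le.2 (by omega)
      exact (exists_ne i).imp fun _ h => h.symm
    simpa using (ha i k hk).ne_zero 0
  have hp : Function.Surjective (fun k : Idx r n => k.1) := fun i => ⟨⟨i, ⟨0, hn i⟩⟩, rfl⟩
  obtain ⟨B, _, φ, s, hs, hB⟩ := HasRadicalFactorization.of_surjective (K := 𝕂) hp
    (fun k => l k.1 k.2) (fun k => (hl k.1 k.2).ne') (MvPolynomial (Fin 2) 𝕂) C _
    (radicalRegularFamily_linearForm hα h0)
  obtain ⟨e⟩ := hB.nonempty_ringEquiv 𝕂 hr hα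
  have := hs.isDomain
  have := hs.isIntegrallyClosed
  exact ⟨e.symm.toMulEquiv.isDomain B, .of_equiv e⟩

end Statement2
end

section
/- Let 𝕂 be an algebraically closed field of characteristic zero and R := 𝕂[x,y,z]/⟨x² − y² + z²⟩. Grade R by K := ℤ ⊕ ℤ/2ℤ ⊕ ℤ/2ℤ via deg x = (1,0̄,0̄), deg y = (1,1̄,0̄), deg z = (1,0̄,1̄). Then R is factorially K-graded (every homogeneous nonzero nonunit is a product of K-primes), but R is not a unique factorization domain. -/
open MvPolynomial

section Statement9

/-- The grading group `K = ℤ ⊕ ℤ/2ℤ ⊕ ℤ/2ℤ`. -/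
abbrev K9 := ℤ × ZMod 2 × ZMod 2

/-- The weights `deg x = (1,0̄,0̄)`, `deg y = (1,1̄,0̄)`, `deg z = (1,0̄,1̄)`. -/
def w9 : Fin 3 → K9 := ![(1, 0, 0), (1, 1, 0), (1, 0, 1)]

variable (𝕂 : Type) [Field 𝕂]

/-- The ideal `⟨x² - y² + z²⟩`. -/
noncomputable def I9 : Ideal (MvPolynomial (Fin 3) 𝕂) :=
  Ideal.span {(X 0 : MvPolynomial (Fin 3) 𝕂) ^ 2 - X 1 ^ 2 + X 2 ^ 2}

/-- The ring `R = 𝕂[x,y,z] / ⟨x² - y² + z²⟩`. -/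
abbrev R9 := MvPolynomial (Fin 3) 𝕂 ⧸ I9 𝕂

/-- Homogeneity of degree `d ∈ K` in `R`, via the `K`-grading with
`deg x = (1,0̄,0̄)`, `deg y = (1,1̄,0̄)`, `deg z = (1,0̄,1̄)`. -/
def IsHomog9 (d : K9) (y : R9 𝕂) : Prop :=
  ∃ p : MvPolynomial (Fin 3) 𝕂, p.IsWeightedHomogeneous w9 d ∧
    Ideal.Quotient.mk (I9 𝕂) p = y

/-- `K`-prime elements of `R`. -/
def KPrime9 (f : R9 𝕂) : Prop :=
  (∃ d, IsHomog9 𝕂 d f) ∧ f ≠ 0 ∧ ¬ IsUnit f ∧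
    ∀ x y : R9 𝕂, (∃ d, IsHomog9 𝕂 d x) → (∃ d, IsHomog9 𝕂 d y) →
      f ∣ x * y → f ∣ x ∨ f ∣ y

/-- The classes of the variables `x`, `y`, `z` in `R`. -/
noncomputable def gen9 (i : Fin 3) : R9 𝕂 := Ideal.Quotient.mk (I9 𝕂) (X i)

variable {𝕂}

theorem gen9_one_sq : gen9 𝕂 1 ^ 2 = gen9 𝕂 0 ^ 2 + gen9 𝕂 2 ^ 2 := by
  have h : Ideal.Quotient.mk (I9 𝕂) (X 0 ^ 2 - X 1 ^ 2 + X 2 ^ 2) = 0 :=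
    Ideal.Quotient.eq_zero_iff_mem.2 (Ideal.subset_span rfl)
  simp only [map_add, map_sub, map_pow] at h
  unfold gen9
  linear_combination -h

/-- The algebra homomorphism out of `R` given by a point of the conic `x² - y² + z² = 0`. -/
noncomputable def evalAt9 {A : Type*} [CommRing A] [Algebra 𝕂 A] (P : Fin 3 → A)
    (hP : P 1 ^ 2 = P 0 ^ 2 + P 2 ^ 2) : R9 𝕂 →ₐ[𝕂] A :=
  Ideal.Quotient.liftₐ (I9 𝕂) (aeval P) fun a ha => by
    have h : I9 𝕂 ≤ RingHom.ker (aeval P : MvPolynomial (Fin 3) 𝕂 →ₐ[𝕂] A) := by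
      refine Ideal.span_le.2 (Set.singleton_subset_iff.2 ?_)
      simp only [SetLike.mem_coe, RingHom.mem_ker, map_add, map_sub, map_pow, aeval_X, hP]
      ring
    exact h ha

@[simp]
theorem evalAt9_gen9 {A : Type*} [CommRing A] [Algebra 𝕂 A] (P : Fin 3 → A)
    (hP : P 1 ^ 2 = P 0 ^ 2 + P 2 ^ 2) (i : Fin 3) : evalAt9 (𝕂 := 𝕂) P hP (gen9 𝕂 i) = P i :=
  (Ideal.Quotient.lift_mk _ _ _).trans (aeval_X P i)

theorem R9.algHom_ext {A : Type*} [CommRing A] [Algebra 𝕂 A] {f g : R9 𝕂 →ₐ[𝕂] A}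
    (h : ∀ i, f (gen9 𝕂 i) = g (gen9 𝕂 i)) : f = g :=
  Ideal.Quotient.algHom_ext _ (MvPolynomial.algHom_ext h)

theorem mk_monomial9 (e : Fin 3 →₀ ℕ) (c : 𝕂) :
    Ideal.Quotient.mk (I9 𝕂) (monomial e c) =
      algebraMap 𝕂 (R9 𝕂) c * (gen9 𝕂 0 ^ e 0 * gen9 𝕂 1 ^ e 1 * gen9 𝕂 2 ^ e 2) := by
  rw [monomial_eq, Finsupp.prod_fintype _ _ (by simp), Fin.prod_univ_three]
  simp only [map_mul, map_pow]
  rfl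

/-- The constants, the variables, and the forms `αx² + βz²`. -/
def factors9 (𝕂 : Type) [Field 𝕂] : Set (R9 𝕂) :=
  {g | (∃ c, g = algebraMap 𝕂 (R9 𝕂) c) ∨ (∃ i, g = gen9 𝕂 i) ∨
    ∃ α β : 𝕂, g = algebraMap 𝕂 (R9 𝕂) α * gen9 𝕂 0 ^ 2 + algebraMap 𝕂 (R9 𝕂) β * gen9 𝕂 2 ^ 2}

theorem aeval_homogenize_mem [IsAlgClosed 𝕂] {A : Type*} [CommRing A] [Algebra 𝕂 A]
    {S : Submonoid A} {u v : A} (hc : ∀ c, algebraMap 𝕂 A c ∈ S)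
    (hS : ∀ α β : 𝕂, algebraMap 𝕂 A α * u + algebraMap 𝕂 A β * v ∈ S) (m : ℕ) :
    ∀ p : Polynomial 𝕂, p.natDegree ≤ m → aeval ![u, v] (p.homogenize m) ∈ S := by
  have hv : v ∈ S := by simpa using hS 0 1
  induction m with
  | zero =>
    intro p hp
    rw [Polynomial.eq_C_of_natDegree_le_zero hp]
    simpa using hc _
  | succ m ih =>
    intro p hp
    by_cases h0 : p.natDegree = 0
    · rw [Polynomial.eq_C_of_natDegree_eq_zero h0]
      simpa using mul_mem (hc _) (pow_mem hv (m + 1))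
    · obtain ⟨r, hr⟩ := IsAlgClosed.exists_root p
        (fun h => h0 (Polynomial.natDegree_eq_of_degree_eq_some h))
      obtain ⟨q, rfl⟩ := Polynomial.dvd_iff_isRoot.2 hr
      have hq : q ≠ 0 := by rintro rfl; simp at h0
      rw [Polynomial.natDegree_mul (Polynomial.X_sub_C_ne_zero r) hq,
        Polynomial.natDegree_X_sub_C] at hp
      rw [add_comm m 1, Polynomial.homogenize_mul _ _ (by simp) (by omega), map_mul]
      refine mul_mem ?_ (ih q (by omega))
      simpa [sub_eq_add_neg] using hS 1 (-r)

theorem homogenize_term (i j k : ℕ) (c : 𝕂) :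
    (Polynomial.C c * (Polynomial.X ^ i * (Polynomial.X + 1) ^ j)).homogenize (i + j + k) =
      C c * (X 0 ^ i * (X 0 + X 1) ^ j * X 1 ^ k) := by
  rw [Polynomial.homogenize_C_mul]
  congr 1
  apply Polynomial.homogenize_eq_of_isHomogeneous
  · refine ((isHomogeneous_X_pow 0 i).mul ?_).mul (isHomogeneous_X_pow 1 k)
    simpa using ((isHomogeneous_X 𝕂 (0 : Fin 2)).add (isHomogeneous_X 𝕂 1)).pow j
  · simp

theorem natDegree_term_le (i j k : ℕ) (c : 𝕂) :
    (Polynomial.C c * (Polynomial.X ^ i * (Polynomial.X + 1) ^ j)).natDegree ≤ i + j + k := by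
  have : (Polynomial.C c * (Polynomial.X ^ i * (Polynomial.X + 1) ^ j)).natDegree ≤ i + j := by
    compute_degree
  omega

theorem IsHomog9.mem_closure [IsAlgClosed 𝕂] {d : K9} {f : R9 𝕂} (hf : IsHomog9 𝕂 d f) :
    f ∈ Submonoid.closure (factors9 𝕂) := by
  obtain ⟨p, hp, rfl⟩ := hf
  have hconst (c : 𝕂) : algebraMap 𝕂 (R9 𝕂) c ∈ Submonoid.closure (factors9 𝕂) :=
    Submonoid.subset_closure (Or.inl ⟨c, rfl⟩)
  have hgen (i : Fin 3) : gen9 𝕂 i ∈ Submonoid.closure (factors9 𝕂) :=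
    Submonoid.subset_closure (Or.inr (Or.inl ⟨i, rfl⟩))
  rcases eq_or_ne p 0 with rfl | hp0
  · simpa using hconst 0
  obtain ⟨e₀, he₀⟩ := Finset.nonempty_of_ne_empty (mt support_eq_empty.1 hp0)
  have hw (e) (he : e ∈ p.support) :
      (e 0 + e 1 + e 2 : ℤ) = d.1 ∧ (e 1 : ZMod 2) = d.2.1 ∧ (e 2 : ZMod 2) = d.2.2 := by
    have h := hp (mem_support_iff.1 he)
    rw [Finsupp.weight_apply, Finsupp.sum_fintype _ _ (by simp), Fin.sum_univ_three] at h
    rw [← h]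
    simp [w9]
  have hpar (e) (he : e ∈ p.support) : e 0 % 2 = e₀ 0 % 2 ∧ e 1 % 2 = e₀ 1 % 2 ∧
      e 2 % 2 = e₀ 2 % 2 ∧ e 0 / 2 + e 1 / 2 + e 2 / 2 = e₀ 0 / 2 + e₀ 1 / 2 + e₀ 2 / 2 := by
    obtain ⟨h, h1, h2⟩ := hw e he
    obtain ⟨h', h1', h2'⟩ := hw e₀ he₀
    have a1 := (ZMod.natCast_eq_natCast_iff' _ _ 2).1 (h1.trans h1'.symm)
    have a2 := (ZMod.natCast_eq_natCast_iff' _ _ 2).1 (h2.trans h2'.symm)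
    omega
  set m := e₀ 0 / 2 + e₀ 1 / 2 + e₀ 2 / 2
  let P : Polynomial 𝕂 := ∑ e ∈ p.support, Polynomial.C (p.coeff e) *
    (Polynomial.X ^ (e 0 / 2) * (Polynomial.X + 1) ^ (e 1 / 2))
  have hP : P.natDegree ≤ m := Polynomial.natDegree_sum_le_of_forall_le _ _ fun e he => by
    rw [← (hpar e he).2.2.2]
    exact natDegree_term_le _ _ _ _
  have key : Ideal.Quotient.mk (I9 𝕂) p =
      gen9 𝕂 0 ^ (e₀ 0 % 2) * gen9 𝕂 1 ^ (e₀ 1 % 2) * gen9 𝕂 2 ^ (e₀ 2 % 2) *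
        aeval ![gen9 𝕂 0 ^ 2, gen9 𝕂 2 ^ 2] (P.homogenize m) := by
    conv_lhs => rw [p.as_sum]
    rw [Polynomial.homogenize_finsetSum, map_sum, map_sum, Finset.mul_sum]
    refine Finset.sum_congr rfl fun e he => ?_
    obtain ⟨h0, h1, h2, hm⟩ := hpar e he
    rw [← hm, homogenize_term, mk_monomial9, ← h0, ← h1, ← h2]
    simp only [map_mul, map_add, map_pow, aeval_X, algHom_C, Matrix.cons_val_zero,
      Matrix.cons_val_one]
    rw [← gen9_one_sq]
    conv_lhs =>
      rw [← Nat.mod_add_div (e 0) 2, ← Nat.mod_add_div (e 1) 2, ← Nat.mod_add_div (e 2) 2]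
    simp only [pow_add, pow_mul]
    ring
  rw [key]
  refine mul_mem (mul_mem (mul_mem (pow_mem (hgen 0) _) (pow_mem (hgen 1) _))
    (pow_mem (hgen 2) _)) (aeval_homogenize_mem hconst (fun α β => ?_) m P hP)
  exact Submonoid.subset_closure (Or.inr (Or.inr ⟨α, β, rfl⟩))

/-- A homogeneous element vanishing at a point `P` of the conic is `K`-prime as soon as it divides
every variable and every form `αx² + βz²` vanishing at `P`. -/
theorem kPrime9_of_point [IsAlgClosed 𝕂] {f : R9 𝕂} (hf : ∃ d, IsHomog9 𝕂 d f) (hf0 : f ≠ 0)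
    (P : Fin 3 → 𝕂) (hP : P 1 ^ 2 = P 0 ^ 2 + P 2 ^ 2) (hfP : evalAt9 (𝕂 := 𝕂) P hP f = 0)
    (hgen : ∀ i, P i = 0 → f ∣ gen9 𝕂 i)
    (hquad : ∀ α β : 𝕂, α * P 0 ^ 2 + β * P 2 ^ 2 = 0 →
      f ∣ algebraMap 𝕂 (R9 𝕂) α * gen9 𝕂 0 ^ 2 + algebraMap 𝕂 (R9 𝕂) β * gen9 𝕂 2 ^ 2) :
    KPrime9 𝕂 f := by
  have hdvd (x : R9 𝕂) (hx : ∃ d, IsHomog9 𝕂 d x) (h : evalAt9 (𝕂 := 𝕂) P hP x = 0) : f ∣ x := by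
    obtain ⟨d, hd⟩ := hx
    revert h
    refine Submonoid.closure_induction (motive := fun x _ => evalAt9 (𝕂 := 𝕂) P hP x = 0 → f ∣ x)
      ?_ ?_ ?_ hd.mem_closure
    · rintro x (⟨c, rfl⟩ | ⟨i, rfl⟩ | ⟨α, β, rfl⟩) h
      · have : c = 0 := by simpa using h
        simp [this]
      · exact hgen i (by simpa using h)
      · exact hquad α β (by simpa using h)
    · intro h
      simp at h
    · intro x y _ _ hx hy h
      rw [map_mul, mul_eq_zero] at h
      exact h.elim (fun h => (hx h).mul_right y) (fun h => (hy h).mul_left x)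
  refine ⟨hf, hf0, fun hu => ?_, fun x y hx hy hxy => ?_⟩
  · simpa [hfP] using hu.map (evalAt9 (𝕂 := 𝕂) P hP)
  · have h : evalAt9 (𝕂 := 𝕂) P hP (x * y) = 0 := by
      obtain ⟨g, hg⟩ := hxy
      rw [hg, map_mul, hfP, zero_mul]
    rw [map_mul, mul_eq_zero] at h
    exact h.imp (hdvd x hx) (hdvd y hy)

theorem isHomog9_gen9 (i : Fin 3) : IsHomog9 𝕂 (w9 i) (gen9 𝕂 i) :=
  ⟨X i, isWeightedHomogeneous_X 𝕂 w9 i, rfl⟩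

theorem IsHomog9.algebraMap_mul {d : K9} {f : R9 𝕂} (hf : IsHomog9 𝕂 d f) (c : 𝕂) :
    IsHomog9 𝕂 d (algebraMap 𝕂 (R9 𝕂) c * f) := by
  obtain ⟨p, hp, rfl⟩ := hf
  exact ⟨C c * p, hp.C_mul c, map_mul _ _ _⟩

theorem isHomog9_quadric (α β : 𝕂) : IsHomog9 𝕂 (2, 0, 0)
    (algebraMap 𝕂 (R9 𝕂) α * gen9 𝕂 0 ^ 2 + algebraMap 𝕂 (R9 𝕂) β * gen9 𝕂 2 ^ 2) := by
  refine ⟨C α * X 0 ^ 2 + C β * X 2 ^ 2, ?_, by simp only [map_add, map_mul, map_pow]; rfl⟩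
  exact (((isWeightedHomogeneous_X 𝕂 w9 0).pow 2).C_mul α).add
    (((isWeightedHomogeneous_X 𝕂 w9 2).pow 2).C_mul β)

theorem gen9_ne_zero (i : Fin 3) : gen9 𝕂 i ≠ 0 := by
  intro h
  have h1 := congrArg (evalAt9 (𝕂 := 𝕂) (A := 𝕂) ![1, 1, 0] (by simp)) h
  have h2 := congrArg (evalAt9 (𝕂 := 𝕂) (A := 𝕂) ![0, 1, 1] (by simp)) h
  fin_cases i <;> simp at h1 h2

theorem kPrime9_gen9 [IsAlgClosed 𝕂] (i : Fin 3) : KPrime9 𝕂 (gen9 𝕂 i) := by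
  obtain ⟨ι, hι⟩ := IsAlgClosed.exists_pow_nat_eq (-1 : 𝕂) (n := 2) two_pos
  have hι0 : ι ≠ 0 := by rintro rfl; simp at hι
  fin_cases i
  · refine kPrime9_of_point ⟨_, isHomog9_gen9 0⟩ (gen9_ne_zero 0) ![0, 1, 1] (by simp) (by simp)
      (fun i hi => ?_) fun α β h => ?_
    · fin_cases i <;> simp at hi ⊢
    · have : β = 0 := by simpa using h
      exact ⟨algebraMap 𝕂 (R9 𝕂) α * gen9 𝕂 0, by simp [this]; ring⟩
  · refine kPrime9_of_point ⟨_, isHomog9_gen9 1⟩ (gen9_ne_zero 1) ![1, 0, ι] (by simp [hι])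
      (by simp) (fun i hi => ?_) fun α β h => ?_
    · fin_cases i <;> simp [hι0] at hi ⊢
    · have : α = β := by simp [hι] at h; linear_combination h
      refine ⟨algebraMap 𝕂 (R9 𝕂) α * gen9 𝕂 1, ?_⟩
      rw [← this]
      simp only [Fin.mk_one]
      linear_combination -algebraMap 𝕂 (R9 𝕂) α * gen9_one_sq (𝕂 := 𝕂)
  · refine kPrime9_of_point ⟨_, isHomog9_gen9 2⟩ (gen9_ne_zero 2) ![1, 1, 0] (by simp) (by simp)
      (fun i hi => ?_) fun α β h => ?_
    · fin_cases i <;> simp at hi ⊢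
    · have : α = 0 := by simpa using h
      exact ⟨algebraMap 𝕂 (R9 𝕂) β * gen9 𝕂 2, by simp [this]; ring⟩

theorem kPrime9_quadric [IsAlgClosed 𝕂] {α β : 𝕂} (hα : α ≠ 0) (hβ : β ≠ 0) (hαβ : α ≠ β) :
    KPrime9 𝕂
      (algebraMap 𝕂 (R9 𝕂) α * gen9 𝕂 0 ^ 2 + algebraMap 𝕂 (R9 𝕂) β * gen9 𝕂 2 ^ 2) := by
  obtain ⟨a, ha⟩ := IsAlgClosed.exists_pow_nat_eq β (n := 2) two_pos
  obtain ⟨b, hb⟩ := IsAlgClosed.exists_pow_nat_eq (β - α) (n := 2) two_pos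
  obtain ⟨c, hc⟩ := IsAlgClosed.exists_pow_nat_eq (-α) (n := 2) two_pos
  refine kPrime9_of_point ⟨_, isHomog9_quadric α β⟩ (fun h => ?_) ![a, b, c]
    (by simp [ha, hb, hc]; ring) (by simp [ha, hc]; ring) (fun i hi => ?_) fun γ δ h => ?_
  · have h1 := congrArg (evalAt9 (𝕂 := 𝕂) (A := 𝕂) ![1, 1, 0] (by simp)) h
    simp [hα] at h1
  · exfalso
    fin_cases i <;> simp at hi <;> subst hi <;> simp at ha hb hc
    · exact hβ ha.symm
    · exact hαβ (sub_eq_zero.1 hb.symm).symm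
    · exact hα hc
  · have h1 : γ * β = δ * α := by
      simp [ha, hc] at h
      linear_combination h
    have h2 : γ = δ / β * α := by field_simp; exact h1
    have h3 : δ = δ / β * β := by field_simp
    refine ⟨algebraMap 𝕂 (R9 𝕂) (δ / β), ?_⟩
    conv_lhs => rw [h2, h3]
    simp only [map_mul]
    field_simp
    ring

theorem KPrime9.algebraMap_mul {p : R9 𝕂} (hp : KPrime9 𝕂 p) {c : 𝕂} (hc : c ≠ 0) :
    KPrime9 𝕂 (algebraMap 𝕂 (R9 𝕂) c * p) := by
  obtain ⟨⟨d, hd⟩, h0, hu, h⟩ := hp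
  have hcu : IsUnit (algebraMap 𝕂 (R9 𝕂) c) := (IsUnit.mk0 c hc).map _
  refine ⟨⟨d, hd.algebraMap_mul c⟩, fun h => h0 (hcu.mul_right_eq_zero.1 h),
    fun h => hu (isUnit_of_mul_isUnit_right h), fun x y hx hy hxy => ?_⟩
  rw [hcu.mul_left_dvd] at hxy ⊢
  rw [hcu.mul_left_dvd]
  exact h x y hx hy hxy

theorem IsHomog9.exists_eq_algebraMap_mul_prod [IsAlgClosed 𝕂] {d : K9} {f : R9 𝕂}
    (hf : IsHomog9 𝕂 d f) : ∃ (c : 𝕂) (ms : Multiset (R9 𝕂)), (∀ p ∈ ms, KPrime9 𝕂 p) ∧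
      f = algebraMap 𝕂 (R9 𝕂) c * ms.prod := by
  refine Submonoid.closure_induction (motive := fun f _ => ∃ (c : 𝕂) (ms : Multiset (R9 𝕂)),
    (∀ p ∈ ms, KPrime9 𝕂 p) ∧ f = algebraMap 𝕂 (R9 𝕂) c * ms.prod) ?_ ?_ ?_ hf.mem_closure
  · rintro x (⟨c, rfl⟩ | ⟨i, rfl⟩ | ⟨α, β, rfl⟩)
    · exact ⟨c, 0, by simp, by simp⟩
    · exact ⟨1, {gen9 𝕂 i}, by simpa using kPrime9_gen9 i, by simp⟩
    · have hsq (i : Fin 3) : ∀ p ∈ ({gen9 𝕂 i, gen9 𝕂 i} : Multiset (R9 𝕂)), KPrime9 𝕂 p := by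
        simpa using kPrime9_gen9 i
      rcases eq_or_ne α 0 with rfl | hα
      · exact ⟨β, _, hsq 2, by simp; ring⟩
      rcases eq_or_ne β 0 with rfl | hβ
      · exact ⟨α, _, hsq 0, by simp; ring⟩
      rcases eq_or_ne α β with rfl | hαβ
      · refine ⟨α, _, hsq 1, ?_⟩
        simp only [Multiset.insert_eq_cons, Multiset.prod_cons, Multiset.prod_singleton]
        linear_combination -algebraMap 𝕂 (R9 𝕂) α * gen9_one_sq (𝕂 := 𝕂)
      · exact ⟨1, {_}, by simpa using kPrime9_quadric hα hβ hαβ, by simp⟩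
  · exact ⟨1, 0, by simp, by simp⟩
  · rintro x y _ _ ⟨c, ms, hms, rfl⟩ ⟨c', ms', hms', rfl⟩
    refine ⟨c * c', ms + ms', fun p hp => ?_, by rw [map_mul, Multiset.prod_add]; ring⟩
    exact (Multiset.mem_add.1 hp).elim (hms p) (hms' p)

/-- The homomorphism `R → R[T]` multiplying each variable by `T`. -/
noncomputable def scale9 (𝕂 : Type) [Field 𝕂] : R9 𝕂 →ₐ[𝕂] Polynomial (R9 𝕂) :=
  evalAt9 (A := Polynomial (R9 𝕂)) (fun i => Polynomial.C (gen9 𝕂 i) * Polynomial.X) <| by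
    have h := congrArg Polynomial.C (gen9_one_sq (𝕂 := 𝕂))
    simp only [map_pow, map_add] at h
    linear_combination Polynomial.X ^ 2 * h

theorem eval_one_scale9 (f : R9 𝕂) : (scale9 𝕂 f).eval 1 = f := by
  have h : ((Polynomial.aeval (1 : R9 𝕂)).restrictScalars 𝕂).comp (scale9 𝕂) =
      AlgHom.id 𝕂 (R9 𝕂) := R9.algHom_ext fun i => by simp [scale9]
  simpa [Polynomial.aeval_def] using DFunLike.congr_fun h f

theorem eval_zero_scale9 (f : R9 𝕂) : ∃ c, (scale9 𝕂 f).eval 0 = algebraMap 𝕂 (R9 𝕂) c := by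
  have h : ((Polynomial.aeval (0 : R9 𝕂)).restrictScalars 𝕂).comp (scale9 𝕂) =
      (Algebra.ofId 𝕂 (R9 𝕂)).comp (evalAt9 0 (by simp)) :=
    R9.algHom_ext fun i => by simp [scale9]
  exact ⟨evalAt9 0 (by simp) f, by
    simpa [Polynomial.aeval_def, Algebra.ofId_apply] using DFunLike.congr_fun h f⟩

theorem exists_eq_algebraMap_of_natDegree_scale9 {f : R9 𝕂} (hf : (scale9 𝕂 f).natDegree = 0) :
    ∃ c, f = algebraMap 𝕂 (R9 𝕂) c := by
  obtain ⟨c, hc⟩ := eval_zero_scale9 f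
  refine ⟨c, ?_⟩
  rw [← hc]
  conv_lhs => rw [← eval_one_scale9 f]
  rw [Polynomial.eq_C_of_natDegree_eq_zero hf]
  simp

theorem not_isUnit_gen9 [IsAlgClosed 𝕂] (i : Fin 3) : ¬ IsUnit (gen9 𝕂 i) :=
  (kPrime9_gen9 i).2.2.1

theorem irreducible_gen9 [IsAlgClosed 𝕂] [IsDomain (R9 𝕂)] (i : Fin 3) :
    Irreducible (gen9 𝕂 i) := by
  refine ⟨not_isUnit_gen9 i, fun a b hab => ?_⟩
  have h0 : a * b ≠ 0 := hab ▸ gen9_ne_zero i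
  have hs : scale9 𝕂 a * scale9 𝕂 b = Polynomial.C (gen9 𝕂 i) * Polynomial.X := by
    rw [← map_mul, ← hab]
    simp [scale9]
  have hs0 : scale9 𝕂 a * scale9 𝕂 b ≠ 0 := by
    rw [hs]
    exact mul_ne_zero (by simpa using gen9_ne_zero i) Polynomial.X_ne_zero
  have hdeg := congrArg Polynomial.natDegree hs
  rw [Polynomial.natDegree_mul (left_ne_zero_of_mul hs0) (right_ne_zero_of_mul hs0),
    Polynomial.natDegree_C_mul_X _ (gen9_ne_zero i)] at hdeg
  have hunit {x : R9 𝕂} (hx : x ≠ 0) (hd : (scale9 𝕂 x).natDegree = 0) : IsUnit x := by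
    obtain ⟨c, rfl⟩ := exists_eq_algebraMap_of_natDegree_scale9 hd
    exact (IsUnit.mk0 c (by rintro rfl; simp at hx)).map _
  rcases Nat.eq_zero_or_pos (scale9 𝕂 a).natDegree with h | h
  · exact Or.inl (hunit (left_ne_zero_of_mul h0) h)
  · exact Or.inr (hunit (right_ne_zero_of_mul h0) (by omega))

theorem not_prime_gen9_one [IsAlgClosed 𝕂] [CharZero 𝕂] : ¬ Prime (gen9 𝕂 1) := by
  intro h
  obtain ⟨ι, hι⟩ := IsAlgClosed.exists_pow_nat_eq (-1 : 𝕂) (n := 2) two_pos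
  have hι' : ι * ι = -1 := by rw [← hι, sq]
  set j := algebraMap 𝕂 (R9 𝕂) ι with hj
  have hjj : j ^ 2 = -1 := by rw [hj, ← map_pow, hι, map_neg, map_one]
  have hdvd : gen9 𝕂 1 ∣ (gen9 𝕂 0 + j * gen9 𝕂 2) * (gen9 𝕂 0 - j * gen9 𝕂 2) :=
    ⟨gen9 𝕂 1, by linear_combination -gen9_one_sq (𝕂 := 𝕂) - gen9 𝕂 2 ^ 2 * hjj⟩
  rcases h.dvd_or_dvd hdvd with ⟨g, hg⟩ | ⟨g, hg⟩
  · have := congrArg (evalAt9 (𝕂 := 𝕂) (A := 𝕂) ![1, 0, -ι] (by simp [hι])) hg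
    simp [hj, hι'] at this
  · have := congrArg (evalAt9 (𝕂 := 𝕂) (A := 𝕂) ![1, 0, ι] (by simp [hι])) hg
    simp [hj, hι'] at this

theorem Irreducible.prime_of_eq_prod_primes {M : Type*} [CommRing M] [IsDomain M] {a : M}
    (ha : Irreducible a) {ms : Multiset M} (hms : ∀ p ∈ ms, Prime p) (h : ms.prod = a) :
    Prime a := by
  obtain ⟨p, hp⟩ := Multiset.exists_mem_of_ne_zero (s := ms) (by
    rintro rfl
    exact ha.not_isUnit (by simp [← h]))
  exact ((hms p hp).irreducible.associated_of_dvd ha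
    (h ▸ Multiset.dvd_prod hp)).prime (hms p hp)

variable (𝕂)

/-- `R = 𝕂[x,y,z]/⟨x²-y²+z²⟩`, graded by `K = ℤ ⊕ ℤ/2ℤ ⊕ ℤ/2ℤ`, is factorially
`K`-graded, but it is not a unique factorization domain (i.e. it is not an integral
domain in which every nonzero nonunit is a product of prime elements). -/
theorem statement9 (𝕂 : Type) [Field 𝕂] [IsAlgClosed 𝕂] [CharZero 𝕂] :
    (∀ f : R9 𝕂, (∃ d, IsHomog9 𝕂 d f) → f ≠ 0 → ¬ IsUnit f →
      ∃ ms : Multiset (R9 𝕂), (∀ p ∈ ms, KPrime9 𝕂 p) ∧ ms.prod = f) ∧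
    ¬ (IsDomain (R9 𝕂) ∧
        ∀ f : R9 𝕂, f ≠ 0 → ¬ IsUnit f →
          ∃ ms : Multiset (R9 𝕂), (∀ p ∈ ms, Prime p) ∧ ms.prod = f) := by
  refine ⟨fun f ⟨d, hd⟩ hf0 hfu => ?_, fun ⟨_, h⟩ => ?_⟩
  · obtain ⟨c, ms, hms, rfl⟩ := hd.exists_eq_algebraMap_mul_prod
    have hc : c ≠ 0 := by rintro rfl; simp at hf0
    obtain ⟨p, hp⟩ := Multiset.exists_mem_of_ne_zero (s := ms) (by
      rintro rfl
      exact hfu (by simpa using (IsUnit.mk0 c hc).map (algebraMap 𝕂 (R9 𝕂))))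
    obtain ⟨t, rfl⟩ := Multiset.exists_cons_of_mem hp
    refine ⟨(algebraMap 𝕂 (R9 𝕂) c * p) ::ₘ t, fun q hq => ?_, by simp [mul_assoc]⟩
    rcases Multiset.mem_cons.1 hq with rfl | hq
    · exact (hms p hp).algebraMap_mul hc
    · exact hms q (Multiset.mem_cons_of_mem hq)
  · obtain ⟨ms, hms, hprod⟩ := h (gen9 𝕂 1) (gen9_ne_zero 1) (not_isUnit_gen9 1)
    exact not_prime_gen9_one ((irreducible_gen9 1).prime_of_eq_prod_primes hms hprod)

end Statement9
end
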